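/- Let n be a positive integer, and let (m_1, …, m_r) and (n_1, …, n_s) be two partitions of n (i.e., tuples of positive integers with m_1 + … + m_r = n_1 + … + n_s = n) that are distinct as multisets. Then the product spaces ℂP^{m_1} × ⋯ × ℂP^{m_r} and ℂP^{n_1} × ⋯ × ℂP^{n_s} are not homeomorphic (in particular they are non-isomorphic as complex varieties). -/

import Mathlib

/-- The quotient topology on a projectivization: `Projectivization K V` is the quotient of the
subspace of nonzero vectors of `V` by the scaling action, and inherits the quotient topology. -/
instance {K V : Type*} [DivisionRing K] [AddCommGroup V] [Module K V] [TopologicalSpace V] :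
    TopologicalSpace (Projectivization K V) :=
  inferInstanceAs (TopologicalSpace (Quotient (projectivizationSetoid K V)))

namespace MPS
set_option linter.unusedSectionVars false
open Set Topology Filter

/-! ### Cochains on lists with coefficients in `ZMod 2` -/

lemma z2 (a : ZMod 2) : a + a = 0 := CharTwo.add_self_eq_zero a

/-- The (augmented) Alexander–Spanier differential, on functions of lists. -/
def dl {X : Type} : (List X → ZMod 2) → List X → ZMod 2
  | _, [] => 0
  | f, x :: l => f l + dl (fun m => f (x :: m)) l

section algebra
variable {X Y : Type}

lemma dl_nil (f : List X → ZMod 2) : dl f [] = 0 := rfl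
lemma dl_cons (f : List X → ZMod 2) (x : X) (l : List X) :
    dl f (x :: l) = f l + dl (fun m => f (x :: m)) l := rfl

lemma dl_add (f g : List X → ZMod 2) (l : List X) : dl (f + g) l = dl f l + dl g l := by
  induction l generalizing f g with
  | nil => simp [dl_nil]
  | cons x l ih =>
    have := ih (fun m => f (x :: m)) (fun m => g (x :: m))
    simp only [dl_cons, Pi.add_apply]
    rw [show (fun m => f (x :: m) + g (x :: m)) =
      (fun m => f (x :: m)) + (fun m => g (x :: m)) from rfl, this]
    ring

lemma dl_smul (c : ZMod 2) (f : List X → ZMod 2) (l : List X) :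
    dl (fun m => c * f m) l = c * dl f l := by
  induction l generalizing f with
  | nil => simp [dl_nil]
  | cons x l ih =>
    simp only [dl_cons]
    rw [ih (fun m => f (x :: m))]
    ring

lemma dl_zero (l : List X) : dl (0 : List X → ZMod 2) l = 0 := by
  have := dl_smul 0 (0 : List X → ZMod 2) l
  rw [zero_mul] at this
  rw [← this]
  congr 1

lemma dl_dl (f : List X → ZMod 2) (l : List X) : dl (dl f) l = 0 := by
  induction l generalizing f with
  | nil => rfl
  | cons x l ih =>
    rw [dl_cons]
    have : (fun m => dl f (x :: m)) = f + dl (fun m => f (x :: m)) := by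
      funext m; simp [dl_cons]
    rw [this, dl_add, ih, add_zero, z2]

lemma dl_map (g : X → Y) (f : List Y → ZMod 2) (l : List X) :
    dl (fun m => f (m.map g)) l = dl f (l.map g) := by
  induction l generalizing f with
  | nil => rfl
  | cons x l ih =>
    simp only [dl_cons, List.map_cons]
    rw [ih (fun m => f (g x :: m))]

lemma dl_congr (f g : List X → ZMod 2) (l : List X)
    (h : ∀ m : List X, m.Sublist l → m.length + 1 = l.length → f m = g m) : dl f l = dl g l := by
  induction l generalizing f g with
  | nil => rfl
  | cons x l ih =>
    rw [dl_cons, dl_cons, h l (List.sublist_cons_self x l) (by simp)]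
    congr 1
    apply ih
    intro m hm hl
    exact h _ (hm.cons_cons x) (by simp [hl])

/-- The prism operator. -/
def prism (f g : X → Y) : (List Y → ZMod 2) → List X → ZMod 2
  | _, [] => 0
  | φ, x :: l => φ (f x :: g x :: l.map g) + prism f g (fun m => φ (f x :: m)) l

lemma prism_add (f g : X → Y) (φ ψ : List Y → ZMod 2) (l : List X) :
    prism f g (φ + ψ) l = prism f g φ l + prism f g ψ l := by
  induction l generalizing φ ψ with
  | nil => simp [prism]
  | cons x l ih =>
    have := ih (fun m => φ (f x :: m)) (fun m => ψ (f x :: m))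
    simp only [prism, Pi.add_apply]
    rw [show (fun m => φ (f x :: m) + ψ (f x :: m)) =
      (fun m => φ (f x :: m)) + (fun m => ψ (f x :: m)) from rfl, this]
    ring

lemma prism_formula (f g : X → Y) (φ : List Y → ZMod 2) (l : List X) :
    dl (prism f g φ) l + prism f g (dl φ) l = φ (l.map f) + φ (l.map g) := by
  induction l generalizing φ with
  | nil => simp [dl_nil, prism, z2]
  | cons x l ih =>
    have h1 : (fun m => prism f g φ (x :: m)) =
        (fun m => φ (f x :: g x :: m.map g)) + prism f g (fun m => φ (f x :: m)) := by
      funext m; simp [prism]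
    have h2 : (fun m => dl φ (f x :: m)) = φ + dl (fun m => φ (f x :: m)) := by
      funext m; simp [dl_cons]
    have h3 := dl_map g (fun m => φ (f x :: g x :: m)) l
    have h4 := ih (fun m => φ (f x :: m))
    rw [dl_cons, h1, dl_add, h3]
    simp only [prism]
    rw [h2, prism_add]
    simp only [dl_cons, List.map_cons]
    have e1 := z2 (prism f g φ l)
    have e2 := z2 (dl (fun m => φ (f x :: g x :: m)) (l.map g))
    have e3 := z2 (φ (f x :: l.map g))
    linear_combination e1 + e2 + h4 + e3

lemma prism_congr (f g : X → Y) (φ ψ : List Y → ZMod 2) (l : List X)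
    (h : ∀ m : List Y, m.length = l.length + 1 →
      (∀ y ∈ m, ∃ x ∈ l, y = f x ∨ y = g x) → φ m = ψ m) :
    prism f g φ l = prism f g ψ l := by
  induction l generalizing φ ψ with
  | nil => rfl
  | cons x l ih =>
    simp only [prism]
    congr 1
    · apply h
      · simp
      · intro y hy
        simp only [List.mem_cons, List.mem_map] at hy
        rcases hy with rfl | rfl | ⟨z, hz, rfl⟩
        · exact ⟨x, by simp, Or.inl rfl⟩
        · exact ⟨x, by simp, Or.inr rfl⟩
        · exact ⟨z, by simp [hz], Or.inr rfl⟩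
    · apply ih
      intro m hm hy
      apply h
      · simp [hm]
      · intro y hy'
        simp only [List.mem_cons] at hy'
        rcases hy' with rfl | hy'
        · exact ⟨x, by simp, Or.inl rfl⟩
        · obtain ⟨z, hz, h⟩ := hy y hy'
          exact ⟨z, by simp [hz], h⟩

lemma prism_zero (f g : X → Y) (l : List X) : prism f g 0 l = 0 := by
  have := prism_add f g 0 0 l
  simpa using this

end algebra

/-! ### Local cocycles and coboundaries -/

/-- `P` holds for all lists of points of `A` which are close to each other. -/
def LocOn {X : Type} [TopologicalSpace X] (A : Set X) (P : List X → Prop) : Prop :=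
  ∀ x ∈ A, ∃ U ∈ 𝓝[A] x, ∀ l : List X, (∀ y ∈ l, y ∈ U) → P l

/-- `φ` is a `k`-cocycle on `A`. -/
def Coc {X : Type} [TopologicalSpace X] (k : ℕ) (A : Set X) (φ : List X → ZMod 2) : Prop :=
  LocOn A (fun l => l.length = k + 2 → dl φ l = 0)

/-- `φ` is a `k`-coboundary on `A`. -/
def Cob {X : Type} [TopologicalSpace X] (k : ℕ) (A : Set X) (φ : List X → ZMod 2) : Prop :=
  ∃ ψ, LocOn A (fun l => l.length = k + 1 → φ l = dl ψ l)

section loc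
variable {X Y : Type} [TopologicalSpace X] [TopologicalSpace Y] {A : Set X} {B : Set Y}

lemma LocOn.and {P Q : List X → Prop} (hP : LocOn A P) (hQ : LocOn A Q) :
    LocOn A (fun l => P l ∧ Q l) := by
  intro x hx
  obtain ⟨U, hU, h⟩ := hP x hx
  obtain ⟨V, hV, h'⟩ := hQ x hx
  exact ⟨U ∩ V, inter_mem hU hV, fun l hl => ⟨h l fun y hy => (hl y hy).1,
    h' l fun y hy => (hl y hy).2⟩⟩

lemma LocOn.mono {P Q : List X → Prop} (hP : LocOn A P)
    (h : ∀ l, (∀ y ∈ l, y ∈ A) → P l → Q l) : LocOn A Q := by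
  intro x hx
  obtain ⟨U, hU, h'⟩ := hP x hx
  exact ⟨U ∩ A, inter_mem hU self_mem_nhdsWithin, fun l hl =>
    h l (fun y hy => (hl y hy).2) (h' l fun y hy => (hl y hy).1)⟩

lemma LocOn.of_forall {P : List X → Prop} (h : ∀ l, (∀ y ∈ l, y ∈ A) → P l) : LocOn A P :=
  fun _ _ => ⟨A, self_mem_nhdsWithin, h⟩

lemma LocOn.pull {P : List Y → Prop} (hP : LocOn B P) {f : X → Y} (hf : ContinuousOn f A)
    (hAB : MapsTo f A B) : LocOn A (fun l => P (l.map f)) := by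
  intro x hx
  obtain ⟨U, hU, h⟩ := hP (f x) (hAB hx)
  refine ⟨f ⁻¹' U, ?_, ?_⟩
  · exact ((hf x hx).tendsto_nhdsWithin hAB) hU
  · intro l hl
    apply h
    intro y hy
    obtain ⟨z, hz, rfl⟩ := List.mem_map.1 hy
    exact hl z hz

lemma Coc.pull {k : ℕ} {φ : List Y → ZMod 2} (h : Coc k B φ) {f : X → Y}
    (hf : ContinuousOn f A) (hAB : MapsTo f A B) : Coc k A (fun l => φ (l.map f)) := by
  refine (LocOn.pull h hf hAB).mono ?_
  intro l _ h hl
  rw [dl_map]; exact h (by simpa using hl)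

lemma Cob.pull {k : ℕ} {φ : List Y → ZMod 2} (h : Cob k B φ) {f : X → Y}
    (hf : ContinuousOn f A) (hAB : MapsTo f A B) : Cob k A (fun l => φ (l.map f)) := by
  obtain ⟨ψ, h⟩ := h
  refine ⟨fun l => ψ (l.map f), (LocOn.pull h hf hAB).mono ?_⟩
  intro l _ h hl
  rw [dl_map]; exact h (by simpa using hl)

lemma Coc.restrict {k : ℕ} {φ : List X → ZMod 2} {A' : Set X} (h : Coc k A φ) (hA : A' ⊆ A) :
    Coc k A' φ := by
  simpa using h.pull (f := id) (A := A') continuousOn_id hA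

lemma Cob.restrict {k : ℕ} {φ : List X → ZMod 2} {A' : Set X} (h : Cob k A φ) (hA : A' ⊆ A) :
    Cob k A' φ := by
  simpa using h.pull (f := id) (A := A') continuousOn_id hA

lemma Cob.congr {k : ℕ} {φ φ' : List X → ZMod 2} (h : Cob k A φ)
    (hh : ∀ l, (∀ y ∈ l, y ∈ A) → φ' l = φ l) : Cob k A φ' := by
  obtain ⟨ψ, h⟩ := h
  exact ⟨ψ, h.mono fun l hl h' hk => by rw [hh l hl]; exact h' hk⟩

lemma Cob.coc {k : ℕ} {φ : List X → ZMod 2} (h : Cob k A φ) : Coc k A φ := by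
  obtain ⟨ψ, h⟩ := h
  intro x hx
  obtain ⟨U, hU, h⟩ := h x hx
  refine ⟨U, hU, fun l hl hk => ?_⟩
  rw [dl_congr φ (dl ψ), dl_dl]
  intro m hm hml
  exact h m (fun y hy => hl y (hm.subset hy)) (by omega)

lemma Coc.add {k : ℕ} {φ ψ : List X → ZMod 2} (h : Coc k A φ) (h' : Coc k A ψ) :
    Coc k A (φ + ψ) := by
  refine (LocOn.and h h').mono ?_
  rintro l _ ⟨h1, h2⟩ hl
  rw [dl_add, h1 hl, h2 hl, add_zero]

lemma Cob.add {k : ℕ} {φ ψ : List X → ZMod 2} (h : Cob k A φ) (h' : Cob k A ψ) :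
    Cob k A (φ + ψ) := by
  obtain ⟨a, h⟩ := h
  obtain ⟨b, h'⟩ := h'
  refine ⟨a + b, (LocOn.and h h').mono ?_⟩
  rintro l _ ⟨h1, h2⟩ hl
  rw [dl_add, Pi.add_apply, h1 hl, h2 hl]

lemma Cob.zero {k : ℕ} : Cob k A 0 :=
  ⟨0, LocOn.of_forall fun l _ _ => by rw [dl_zero]; rfl⟩

lemma co_add_self (φ : List X → ZMod 2) : φ + φ = 0 := by
  funext l; exact z2 _

lemma Cob.cancel {k : ℕ} {φ ψ : List X → ZMod 2} (h : Cob k A (φ + ψ)) (h' : Cob k A ψ) :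
    Cob k A φ := by
  have := h.add h'
  rwa [add_assoc, co_add_self, add_zero] at this

lemma Coc.cancel {k : ℕ} {φ ψ : List X → ZMod 2} (h : Coc k A (φ + ψ)) (h' : Coc k A ψ) :
    Coc k A φ := by
  have := h.add h'
  rwa [add_assoc, co_add_self, add_zero] at this

lemma Coc.sum {k : ℕ} {ι : Type} (s : Finset ι) (φ : ι → List X → ZMod 2)
    (h : ∀ i ∈ s, Coc k A (φ i)) : Coc k A (∑ i ∈ s, φ i) := by
  classical
  induction s using Finset.induction_on with
  | empty => simpa using (Cob.zero (k := k) (A := A)).coc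
  | insert i s hi ih =>
    rw [Finset.sum_insert hi]
    exact (h i (by simp)).add (ih fun j hj => h j (by simp [hj]))

lemma Cob.sum {k : ℕ} {ι : Type} (s : Finset ι) (φ : ι → List X → ZMod 2)
    (h : ∀ i ∈ s, Cob k A (φ i)) : Cob k A (∑ i ∈ s, φ i) := by
  classical
  induction s using Finset.induction_on with
  | empty => simpa using (Cob.zero (k := k) (A := A))
  | insert i s hi ih =>
    rw [Finset.sum_insert hi]
    exact (h i (by simp)).add (ih fun j hj => h j (by simp [hj]))

lemma Cob.smul {k : ℕ} {φ : List X → ZMod 2} (h : Cob k A φ) (c : ZMod 2) :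
    Cob k A (c • φ) := by
  obtain ⟨a, h⟩ := h
  refine ⟨fun l => c * a l, h.mono ?_⟩
  intro l _ h1 hl
  rw [dl_smul, Pi.smul_apply, h1 hl, smul_eq_mul]

lemma Coc.smul {k : ℕ} {φ : List X → ZMod 2} (h : Coc k A φ) (c : ZMod 2) :
    Coc k A (c • φ) := by
  refine LocOn.mono h ?_
  intro l _ h1 hl
  have := dl_smul c φ l
  rw [h1 hl, mul_zero] at this
  exact this

/-- Cocycles on a point are coboundaries. -/
lemma Cob.point {k : ℕ} {φ : List X → ZMod 2} {p : X} (h : Coc k {p} φ) : Cob k {p} φ := by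
  refine ⟨fun l => φ (p :: l), LocOn.of_forall fun l hl hk => ?_⟩
  obtain ⟨U, hU, h⟩ := h p (mem_singleton p)
  have hp : p ∈ U := mem_of_mem_nhdsWithin (mem_singleton p) hU
  have := h (p :: l) (by
    intro y hy
    rcases List.mem_cons.1 hy with rfl | hy
    · exact hp
    · rw [hl y hy]; exact hp) (by simp [hk])
  rw [dl_cons] at this
  exact CharTwo.add_eq_zero.1 this

/-- On a preconnected set a `0`-cocycle is constant. -/
lemma Coc.const {φ : List X → ZMod 2} (h : Coc 0 A φ) (hA : IsPreconnected A) :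
    ∀ x ∈ A, ∀ y ∈ A, φ [x] = φ [y] := by
  intro x hx y hy
  have hc : ContinuousOn (fun x => φ [x]) A := by
    intro x hx
    obtain ⟨U, hU, h⟩ := h x hx
    have hxU : x ∈ U := mem_of_mem_nhdsWithin hx hU
    have : ∀ᶠ y in 𝓝[A] x, φ [y] = φ [x] := by
      filter_upwards [hU] with y hy
      have := h [y, x] (by simp [hy, hxU]) rfl
      simp only [dl_cons, dl_nil, add_zero] at this
      exact (CharTwo.add_eq_zero.1 this).symm
    exact (tendsto_congr' this).2 tendsto_const_nhds
  exact hA.constant hc hx hy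

lemma Cob.of_const {φ : List X → ZMod 2} (c : ZMod 2) (h : ∀ x ∈ A, φ [x] = c) : Cob 0 A φ := by
  refine ⟨fun _ => c, LocOn.of_forall fun l hl hk => ?_⟩
  obtain ⟨x, rfl⟩ := List.length_eq_one_iff.1 (by simpa using hk)
  simp [dl_cons, dl_nil, h x (hl x (by simp))]

end loc

/-! ### Homotopy invariance -/

section homotopy
variable {X Y : Type} [TopologicalSpace X] [TopologicalSpace Y] {A : Set X} {B : Set Y}

theorem Coc.homotopy {k : ℕ} {φ : List Y → ZMod 2} (h : Coc k B φ) (hA : IsCompact A)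
    (F : ℝ → X → Y) (hF : ContinuousOn (fun p : ℝ × X => F p.1 p.2) (Icc (0:ℝ) 1 ×ˢ A))
    (hAB : ∀ t ∈ Icc (0:ℝ) 1, ∀ x ∈ A, F t x ∈ B) :
    Cob k A ((fun l => φ (l.map (F 0))) + fun l => φ (l.map (F 1))) := by
  -- local statement
  have key : ∀ t ∈ Icc (0:ℝ) 1, ∀ᶠ s in 𝓝[Icc (0:ℝ) 1] t,
      Cob k A ((fun l => φ (l.map (F t))) + fun l => φ (l.map (F s))) := by
    intro t ht
    have hJ : ∃ J ∈ 𝓝[Icc (0:ℝ) 1] t, ∀ x ∈ A, ∃ U ∈ 𝓝[A] x, ∀ l : List Y,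
        (∀ y ∈ l, ∃ s ∈ J, ∃ z ∈ U, y = F s z) → l.length = k + 2 → dl φ l = 0 := by
      refine hA.induction_on (p := fun C => ∃ J ∈ 𝓝[Icc (0:ℝ) 1] t, ∀ x ∈ C, ∃ U ∈ 𝓝[A] x,
        ∀ l : List Y, (∀ y ∈ l, ∃ s ∈ J, ∃ z ∈ U, y = F s z) → l.length = k + 2 → dl φ l = 0)
        ?_ ?_ ?_ ?_
      · exact ⟨univ, univ_mem, by simp⟩
      · rintro C D hCD ⟨J, hJ, h⟩
        exact ⟨J, hJ, fun x hx => h x (hCD hx)⟩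
      · rintro C D ⟨J, hJ, h⟩ ⟨J', hJ', h'⟩
        refine ⟨J ∩ J', inter_mem hJ hJ', ?_⟩
        rintro x (hx | hx)
        · obtain ⟨U, hU, h⟩ := h x hx
          refine ⟨U, hU, fun l hl => h l fun y hy => ?_⟩
          obtain ⟨s, hs, hz⟩ := hl y hy
          exact ⟨s, hs.1, hz⟩
        · obtain ⟨U, hU, h⟩ := h' x hx
          refine ⟨U, hU, fun l hl => h l fun y hy => ?_⟩
          obtain ⟨s, hs, hz⟩ := hl y hy
          exact ⟨s, hs.2, hz⟩
      · intro x hx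
        obtain ⟨V, hV, h⟩ := h (F t x) (hAB t ht x hx)
        have h1 : (fun p : ℝ × X => F p.1 p.2) ⁻¹' V ∈ 𝓝[Icc (0:ℝ) 1 ×ˢ A] (t, x) :=
          ((hF (t, x) ⟨ht, hx⟩).tendsto_nhdsWithin
            (fun p hp => hAB p.1 hp.1 p.2 hp.2)) hV
        rw [nhdsWithin_prod_eq, mem_prod_iff] at h1
        obtain ⟨J, hJ, U, hU, hJU⟩ := h1
        obtain ⟨O, hO, hxO, hOU⟩ := mem_nhdsWithin.1 hU
        refine ⟨O ∩ A, inter_mem (mem_nhdsWithin_of_mem_nhds (hO.mem_nhds hxO))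
          self_mem_nhdsWithin, J, hJ, fun x' hx' => ⟨O ∩ A,
          inter_mem (mem_nhdsWithin_of_mem_nhds (hO.mem_nhds hx'.1)) self_mem_nhdsWithin,
          fun l hl => h l ?_⟩⟩
        intro y hy
        obtain ⟨s, hs, z, hz, rfl⟩ := hl y hy
        exact hJU (show (s, z) ∈ J ×ˢ U from ⟨hs, hOU hz⟩)
    obtain ⟨J, hJ, hJ'⟩ := hJ
    have htJ : t ∈ J := mem_of_mem_nhdsWithin ht hJ
    filter_upwards [hJ] with s hs
    refine ⟨prism (F t) (F s) φ, ?_⟩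
    intro x hx
    obtain ⟨U, hU, h⟩ := hJ' x hx
    refine ⟨U, hU, fun l hl hk => ?_⟩
    have e := prism_formula (F t) (F s) φ l
    rw [prism_congr (F t) (F s) (dl φ) 0, prism_zero, add_zero] at e
    · simp [e]
    · intro m hm hy
      refine h m (fun y hy' => ?_) (by omega)
      obtain ⟨z, hz, h | h⟩ := hy y hy'
      · exact ⟨t, htJ, z, hl z hz, h⟩
      · exact ⟨s, hs, z, hl z hz, h⟩
  have hpre : IsPreconnected (Icc (0:ℝ) 1) := isPreconnected_Icc
  have symm : ∀ s t, Cob k A ((fun l => φ (l.map (F t))) + fun l => φ (l.map (F s))) →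
      Cob k A ((fun l => φ (l.map (F s))) + fun l => φ (l.map (F t))) := by
    intro s t h; rwa [add_comm]
  have trans : ∀ r s t, Cob k A ((fun l => φ (l.map (F r))) + fun l => φ (l.map (F s))) →
      Cob k A ((fun l => φ (l.map (F s))) + fun l => φ (l.map (F t))) →
      Cob k A ((fun l => φ (l.map (F r))) + fun l => φ (l.map (F t))) := by
    intro r s t h h'
    have := h.add h'
    rw [add_assoc, ← add_assoc (fun l : List X => φ (l.map (F s))), co_add_self, zero_add] at this
    exact this
  classical
  let χ : ℝ → ℕ := fun s =>
    if Cob k A ((fun l => φ (l.map (F 0))) + fun l => φ (l.map (F s))) then 0 else 1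
  have hχ : ContinuousOn χ (Icc 0 1) := by
    intro t ht
    have : ∀ᶠ s in 𝓝[Icc (0:ℝ) 1] t, χ s = χ t := by
      filter_upwards [key t ht] with s hs
      have : (Cob k A ((fun l => φ (l.map (F 0))) + fun l => φ (l.map (F s)))) ↔
        (Cob k A ((fun l => φ (l.map (F 0))) + fun l => φ (l.map (F t)))) :=
        ⟨fun h => trans _ _ _ h (symm _ _ hs), fun h => trans _ _ _ h hs⟩
      simp only [χ, this]
    exact (tendsto_congr' this).2 tendsto_const_nhds
  have h01 : χ 0 = χ 1 := hpre.constant hχ (by simp) (by simp)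
  have h0 : χ 0 = 0 := by
    have : Cob k A ((fun l => φ (l.map (F 0))) + fun l => φ (l.map (F 0))) := by
      rw [co_add_self]; exact Cob.zero
    simp only [χ]
    rw [if_pos this]
  by_contra hcon
  have h1 : χ 1 = 1 := by
    simp only [χ]
    rw [if_neg hcon]
  omega

/-- If a homotopy ends in the identity and the pullback along its beginning is a coboundary,
then so is the cocycle. -/
theorem Coc.contract {k : ℕ} {φ : List X → ZMod 2} {B : Set X} (h : Coc k B φ) (hA : IsCompact A)
    (F : ℝ → X → X) (hF : ContinuousOn (fun p : ℝ × X => F p.1 p.2) (Icc (0:ℝ) 1 ×ˢ A))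
    (hAB : ∀ t ∈ Icc (0:ℝ) 1, ∀ x ∈ A, F t x ∈ B) (h1 : ∀ x ∈ A, F 1 x = x)
    (h0 : Cob k A (fun l => φ (l.map (F 0)))) : Cob k A φ := by
  have := h.homotopy hA F hF hAB
  rw [add_comm] at this
  refine (this.cancel h0).congr ?_
  intro l hl
  have : l.map (F 1) = l := by
    conv_rhs => rw [← List.map_id l]
    exact List.map_congr_left fun x hx => h1 x (hl x hx)
  rw [this]

end homotopy

/-! ### Mayer–Vietoris -/

section MV
variable {X : Type} [TopologicalSpace X]

theorem mv_core {k : ℕ} {Z A B : Set X} (hA : IsClosed A) (hB : IsClosed B)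
    (hAB : ∀ x ∈ Z, A ∈ 𝓝 x ∨ B ∈ 𝓝 x) {φ ψA ψB : List X → ZMod 2}
    (h1 : LocOn (Z ∩ A) (fun l => l.length = k + 2 → φ l = dl ψA l))
    (h2 : LocOn (Z ∩ B) (fun l => l.length = k + 2 → φ l = dl ψB l))
    (h3 : Cob k (Z ∩ A ∩ B) (ψA + ψB)) : Cob (k + 1) Z φ := by
  classical
  obtain ⟨ω, hω⟩ := h3
  let ω' : List X → ZMod 2 := fun l => if ∀ y ∈ l, y ∈ A ∩ B then ω l else 0
  let ψ : List X → ZMod 2 := fun l => if ∀ y ∈ l, y ∈ B then ψB l else ψA l + dl ω' l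
  refine ⟨ψ, fun x hx => ?_⟩
  rcases hAB x hx with hxA | hxB
  · have hxA' := mem_of_mem_nhds hxA
    obtain ⟨U, hU, h⟩ := h1 x ⟨hx, hxA'⟩
    have hUZ : U ∈ 𝓝[Z] x := by
      rw [inter_comm, nhdsWithin_inter_of_mem (mem_nhdsWithin_of_mem_nhds hxA)] at hU; exact hU
    have hV : ∃ V ∈ 𝓝[Z] x, ∀ l : List X, (∀ y ∈ l, y ∈ V) → (∀ y ∈ l, y ∈ B) →
        l ≠ [] → l.length = k + 1 → ψA l + ψB l = dl ω l := by
      by_cases hxB : x ∈ B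
      · obtain ⟨V, hV, h⟩ := hω x ⟨⟨hx, hxA'⟩, hxB⟩
        obtain ⟨O, hO, hxO, hOV⟩ := mem_nhdsWithin.1 hV
        refine ⟨O ∩ A ∩ Z, inter_mem (mem_nhdsWithin_of_mem_nhds
          (inter_mem (hO.mem_nhds hxO) hxA)) self_mem_nhdsWithin, fun l hl hlB _ hk => ?_⟩
        exact h l (fun y hy => hOV ⟨(hl y hy).1.1, ⟨(hl y hy).2, (hl y hy).1.2⟩, hlB y hy⟩) hk
      · refine ⟨Bᶜ, mem_nhdsWithin_of_mem_nhds (hB.isOpen_compl.mem_nhds hxB), ?_⟩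
        intro l hl hlB hne
        obtain ⟨y, hy⟩ := List.exists_mem_of_ne_nil l hne
        exact absurd (hlB y hy) (hl y hy)
    obtain ⟨V, hV, h'⟩ := hV
    refine ⟨U ∩ V ∩ A, inter_mem (inter_mem hUZ hV) (mem_nhdsWithin_of_mem_nhds hxA),
      fun l hl hk => ?_⟩
    have e : dl ψ l = dl (ψA + dl ω') l := by
      apply dl_congr
      intro m hm hml
      have hm' : ∀ y ∈ m, y ∈ U ∩ V ∩ A := fun y hy => hl y (hm.subset hy)
      by_cases hmB : ∀ y ∈ m, y ∈ B
      · simp only [ψ, if_pos hmB, Pi.add_apply]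
        have e1 := h' m (fun y hy => (hm' y hy).1.2) hmB (by rintro rfl; simp at hml; omega)
          (by omega)
        have e2 : dl ω' m = dl ω m := by
          apply dl_congr
          intro n hn _
          simp only [ω']
          rw [if_pos]
          intro y hy
          exact ⟨(hm' y (hn.subset hy)).2, hmB y (hn.subset hy)⟩
        rw [e2, ← e1, ← add_assoc, z2, zero_add]
      · simp only [ψ, if_neg hmB, Pi.add_apply]
    rw [e, dl_add, dl_dl, add_zero]
    exact h l (fun y hy => (hl y hy).1.1) hk
  · have hxB' := mem_of_mem_nhds hxB
    obtain ⟨U, hU, h⟩ := h2 x ⟨hx, hxB'⟩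
    have hUZ : U ∈ 𝓝[Z] x := by
      rw [inter_comm, nhdsWithin_inter_of_mem (mem_nhdsWithin_of_mem_nhds hxB)] at hU; exact hU
    refine ⟨U ∩ B, inter_mem hUZ (mem_nhdsWithin_of_mem_nhds hxB), fun l hl hk => ?_⟩
    rw [h l (fun y hy => (hl y hy).1) hk]
    apply dl_congr
    intro m hm _
    simp only [ψ]
    rw [if_pos fun y hy => (hl y (hm.subset hy)).2]

end MV
end MPS

namespace MPS
set_option linter.unusedSectionVars false
open Set Topology Filter

/-! ### Relative triviality statements for products -/

/-- every `k`-cocycle on `Y × S` trivial on `Y × {p}` is trivial on `Y × A`. -/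
def RT (k : ℕ) {Z : Type} [TopologicalSpace Z] (S A : Set Z) : Prop :=
  ∀ (T : Type) [TopologicalSpace T] (Y : Set T), IsCompact Y → IsPreconnected Y →
    ∀ (φ : List (T × Z) → ZMod 2) (p : Z), p ∈ S → Coc k (Y ×ˢ S) φ → Cob k (Y ×ˢ {p}) φ →
      Cob k (Y ×ˢ A) φ

/-- the space of `k`-cocycles on `Y × S` trivial on `Y × {p}` has at most rank one on `Y × A`. -/
def RO (k : ℕ) {Z : Type} [TopologicalSpace Z] (S A : Set Z) : Prop :=
  ∀ (T : Type) [TopologicalSpace T] (Y : Set T), IsCompact Y → IsPreconnected Y →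
    ∀ (φ φ' : List (T × Z) → ZMod 2) (p : Z), p ∈ S →
      Coc k (Y ×ˢ S) φ → Cob k (Y ×ˢ {p}) φ → Coc k (Y ×ˢ S) φ' → Cob k (Y ×ˢ {p}) φ' →
      Cob k (Y ×ˢ A) φ ∨ Cob k (Y ×ˢ A) φ' ∨ Cob k (Y ×ˢ A) (φ + φ')

section
variable {T Z Z' : Type} [TopologicalSpace T] [TopologicalSpace Z] [TopologicalSpace Z']

lemma contOn_pr {Y : Set T} {S : Set Z} {g : Z → Z'} (hg : ContinuousOn g S) :
    ContinuousOn (fun x : T × Z => (x.1, g x.2)) (Y ×ˢ S) :=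
  continuousOn_fst.prodMk (hg.comp continuousOn_snd fun _ hx => hx.2)

lemma Coc.pr {k : ℕ} {Y : Set T} {S : Set Z} {S' : Set Z'} {φ : List (T × Z') → ZMod 2}
    (h : Coc k (Y ×ˢ S') φ) {g : Z → Z'} (hg : ContinuousOn g S) (hm : MapsTo g S S') :
    Coc k (Y ×ˢ S) (fun l => φ (l.map fun x => (x.1, g x.2))) :=
  h.pull (contOn_pr hg) fun _ hx => ⟨hx.1, hm hx.2⟩

lemma Cob.pr {k : ℕ} {Y : Set T} {S : Set Z} {S' : Set Z'} {φ : List (T × Z') → ZMod 2}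
    (h : Cob k (Y ×ˢ S') φ) {g : Z → Z'} (hg : ContinuousOn g S) (hm : MapsTo g S S') :
    Cob k (Y ×ˢ S) (fun l => φ (l.map fun x => (x.1, g x.2))) :=
  h.pull (contOn_pr hg) fun _ hx => ⟨hx.1, hm hx.2⟩

lemma list_map_id_on {X : Type} {A : Set X} {f : X → X} (hf : ∀ x ∈ A, f x = x) {l : List X}
    (hl : ∀ y ∈ l, y ∈ A) : l.map f = l := by
  rw [List.map_congr_left (g := id) (fun y hy => hf y (hl y hy)), List.map_id]

/-- moving the base point -/
lemma Cob.move {k : ℕ} {Y : Set T} (hY : IsCompact Y) {S : Set Z} {φ : List (T × Z) → ZMod 2}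
    (h : Coc k (Y ×ˢ S) φ) {p q : Z} (hpq : JoinedIn S p q) (hp : Cob k (Y ×ˢ {p}) φ) :
    Cob k (Y ×ˢ {q}) φ := by
  obtain ⟨γ, hγ⟩ := hpq
  refine h.contract (hY.prod isCompact_singleton) (fun t x => (x.1, γ.extend t)) ?_ ?_ ?_ ?_
  · apply Continuous.continuousOn
    have := γ.continuous_extend
    fun_prop
  · intro t ht x hx
    refine ⟨hx.1, ?_⟩
    have := hγ ⟨t, ht⟩
    simpa [Path.extend_apply _ ht] using this
  · rintro ⟨y, z⟩ hx
    have : z = q := hx.2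
    simp [this]
  · exact hp.pull (f := fun x : T × Z => (x.1, γ.extend 0)) (by fun_prop)
      (fun x hx => ⟨hx.1, by simp⟩)

lemma deform_core {k : ℕ} {Y : Set T} (hY : IsCompact Y) {S A : Set Z} {S' : Set Z'}
    (hA : IsCompact A) {f : Z → Z'} {g : Z' → Z} (hf : ContinuousOn f A) (hg : ContinuousOn g S')
    (hfm : MapsTo f A S') (hgm : MapsTo g S' S) (F : ℝ → Z → Z)
    (hF : ContinuousOn (fun p : ℝ × Z => F p.1 p.2) (Icc (0:ℝ) 1 ×ˢ A))
    (hFS : ∀ t ∈ Icc (0:ℝ) 1, ∀ x ∈ A, F t x ∈ S) (h1 : ∀ x ∈ A, F 1 x = x)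
    (h0 : ∀ x ∈ A, F 0 x = g (f x)) {φ : List (T × Z) → ZMod 2} (h : Coc k (Y ×ˢ S) φ)
    (h' : Cob k (Y ×ˢ S') (fun l => φ (l.map fun x => (x.1, g x.2)))) :
    Cob k (Y ×ˢ A) φ := by
  refine h.contract (hY.prod hA) (fun t x => (x.1, F t x.2)) ?_ ?_ ?_ ?_
  · refine ContinuousOn.prodMk (by fun_prop) ?_
    exact hF.comp (f := fun p : ℝ × T × Z => (p.1, p.2.2)) (by fun_prop)
      fun p hp => ⟨hp.1, hp.2.2⟩
  · exact fun t ht x hx => ⟨hx.1, hFS t ht x.2 hx.2⟩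
  · exact fun x hx => by rw [h1 x.2 hx.2]
  · refine (h'.pr hf hfm).congr ?_
    intro l hl
    rw [List.map_map]
    congr 1
    apply List.map_congr_left
    intro x hx
    simp only [Function.comp]
    rw [h0 x.2 (hl x hx).2]

lemma RT.deform {k : ℕ} {S A : Set Z} {S' : Set Z'} (hS' : RT k S' S')
    (hA : IsCompact A) {f : Z → Z'} {g : Z' → Z} (hf : ContinuousOn f A) (hg : ContinuousOn g S')
    (hfm : MapsTo f A S') (hgm : MapsTo g S' S) (F : ℝ → Z → Z)
    (hF : ContinuousOn (fun p : ℝ × Z => F p.1 p.2) (Icc (0:ℝ) 1 ×ˢ A))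
    (hFS : ∀ t ∈ Icc (0:ℝ) 1, ∀ x ∈ A, F t x ∈ S) (h1 : ∀ x ∈ A, F 1 x = x)
    (h0 : ∀ x ∈ A, F 0 x = g (f x)) (hmove : ∀ p ∈ S, ∃ s ∈ S', JoinedIn S p (g s)) :
    RT k S A := by
  intro T _ Y hY hYc φ p hp h hb
  obtain ⟨s, hs, hj⟩ := hmove p hp
  refine deform_core hY hA hf hg hfm hgm F hF hFS h1 h0 h ?_
  refine hS' T Y hY hYc _ s hs (h.pr hg hgm) ?_
  exact (hb.move hY h hj).pr (continuousOn_singleton _ _) (fun x hx => by rw [hx]; rfl)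

lemma RO.deform {k : ℕ} {S A : Set Z} {S' : Set Z'} (hS' : RO k S' S')
    (hA : IsCompact A) {f : Z → Z'} {g : Z' → Z} (hf : ContinuousOn f A) (hg : ContinuousOn g S')
    (hfm : MapsTo f A S') (hgm : MapsTo g S' S) (F : ℝ → Z → Z)
    (hF : ContinuousOn (fun p : ℝ × Z => F p.1 p.2) (Icc (0:ℝ) 1 ×ˢ A))
    (hFS : ∀ t ∈ Icc (0:ℝ) 1, ∀ x ∈ A, F t x ∈ S) (h1 : ∀ x ∈ A, F 1 x = x)
    (h0 : ∀ x ∈ A, F 0 x = g (f x)) (hmove : ∀ p ∈ S, ∃ s ∈ S', JoinedIn S p (g s)) :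
    RO k S A := by
  intro T _ Y hY hYc φ φ' p hp h hb h' hb'
  obtain ⟨s, hs, hj⟩ := hmove p hp
  have key := hS' T Y hY hYc _ _ s hs (h.pr hg hgm)
    ((hb.move hY h hj).pr (continuousOn_singleton _ _) (fun x hx => by rw [hx]; rfl))
    (h'.pr hg hgm)
    ((hb'.move hY h' hj).pr (continuousOn_singleton _ _) (fun x hx => by rw [hx]; rfl))
  rcases key with key | key | key
  · exact Or.inl (deform_core hY hA hf hg hfm hgm F hF hFS h1 h0 h key)
  · exact Or.inr (Or.inl (deform_core hY hA hf hg hfm hgm F hF hFS h1 h0 h' key))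
  · exact Or.inr (Or.inr (deform_core hY hA hf hg hfm hgm F hF hFS h1 h0 (h.add h') key))

/-- transport along homeomorphisms -/
lemma RT.transport {k : ℕ} {S : Set Z} {S' : Set Z'} (hS' : RT k S' S')
    {f : Z → Z'} {g : Z' → Z} (hf : ContinuousOn f S) (hg : ContinuousOn g S')
    (hfm : MapsTo f S S') (hgm : MapsTo g S' S) (hgf : ∀ x ∈ S, g (f x) = x) : RT k S S := by
  intro T _ Y hY hYc φ p hp h hb
  have := hS' T Y hY hYc _ (f p) (hfm hp) (h.pr hg hgm)
    (hb.pr (continuousOn_singleton _ _) (fun x hx => by rw [hx, hgf p hp]; rfl))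
  refine (this.pr hf hfm).congr fun l hl => ?_
  rw [List.map_map, list_map_id_on (A := Y ×ˢ S) _ hl]
  intro x hx
  simp [hgf x.2 hx.2]

lemma RO.transport {k : ℕ} {S : Set Z} {S' : Set Z'} (hS' : RO k S' S')
    {f : Z → Z'} {g : Z' → Z} (hf : ContinuousOn f S) (hg : ContinuousOn g S')
    (hfm : MapsTo f S S') (hgm : MapsTo g S' S) (hgf : ∀ x ∈ S, g (f x) = x) : RO k S S := by
  intro T _ Y hY hYc φ φ' p hp h hb h' hb'
  have key := hS' T Y hY hYc _ _ (f p) (hfm hp) (h.pr hg hgm)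
    (hb.pr (continuousOn_singleton _ _) (fun x hx => by rw [hx, hgf p hp]; rfl)) (h'.pr hg hgm)
    (hb'.pr (continuousOn_singleton _ _) (fun x hx => by rw [hx, hgf p hp]; rfl))
  have back : ∀ ψ : List (T × Z) → ZMod 2,
      Cob k (Y ×ˢ S') (fun l => ψ (l.map fun x => (x.1, g x.2))) → Cob k (Y ×ˢ S) ψ := by
    intro ψ this
    refine (this.pr hf hfm).congr fun l hl => ?_
    rw [List.map_map, list_map_id_on (A := Y ×ˢ S) _ hl]
    intro x hx
    simp [hgf x.2 hx.2]
  rcases key with key | key | key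
  · exact Or.inl (back _ key)
  · exact Or.inr (Or.inl (back _ key))
  · exact Or.inr (Or.inr (back (φ + φ') key))

lemma RT.point {k : ℕ} (z : Z) : RT k {z} {z} := by
  intro T _ Y hY hYc φ p hp h hb
  rw [mem_singleton_iff.1 hp] at hb
  exact hb

lemma RT.zero {S : Set Z} (hS : IsPreconnected S) : RT 0 S S := by
  intro T _ Y hY hYc φ p hp h hb
  have := h.const (hYc.prod hS)
  rcases (Y ×ˢ S).eq_empty_or_nonempty with he | ⟨x, hx⟩
  · exact Cob.of_const 0 (by simp [he])
  · exact Cob.of_const (φ [x]) fun y hy => this y hy x hx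

lemma RO.zero {S S₁ S₂ : Set Z} (hS : S = S₁ ∪ S₂) (h₁ : IsPreconnected S₁)
    (h₂ : IsPreconnected S₂) : RO 0 S S := by
  intro T _ Y hY hYc φ φ' p hp h hb h' hb'
  have aux : ∀ (R : Set Z), R ⊆ S → IsPreconnected R → ∀ φ, Coc 0 (Y ×ˢ S) φ →
      ∃ c, ∀ x ∈ Y ×ˢ R, φ [x] = c := by
    intro R hRS hR φ h
    have := (h.restrict (prod_mono_right hRS)).const (hYc.prod hR)
    rcases (Y ×ˢ R).eq_empty_or_nonempty with he | ⟨x, hx⟩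
    · exact ⟨0, by simp [he]⟩
    · exact ⟨_, fun y hy => this y hy x hx⟩
  have s1 : S₁ ⊆ S := hS ▸ subset_union_left
  have s2 : S₂ ⊆ S := hS ▸ subset_union_right
  obtain ⟨a, ha⟩ := aux S₁ s1 h₁ φ h
  obtain ⟨b, hb⟩ := aux S₂ s2 h₂ φ h
  obtain ⟨a', ha'⟩ := aux S₁ s1 h₁ φ' h'
  obtain ⟨b', hb'⟩ := aux S₂ s2 h₂ φ' h'
  have fin : ∀ (ψ : List (T × Z) → ZMod 2) c, (∀ x ∈ Y ×ˢ S₁, ψ [x] = c) →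
      (∀ x ∈ Y ×ˢ S₂, ψ [x] = c) → Cob 0 (Y ×ˢ S) ψ := by
    intro ψ c k1 k2
    apply Cob.of_const c
    intro x hx
    rw [hS] at hx
    rcases hx.2 with hx' | hx'
    · exact k1 x ⟨hx.1, hx'⟩
    · exact k2 x ⟨hx.1, hx'⟩
  by_cases e : a = b
  · exact Or.inl (fin φ a ha (e ▸ hb))
  by_cases e' : a' = b'
  · exact Or.inr (Or.inl (fin φ' a' ha' (e' ▸ hb')))
  · refine Or.inr (Or.inr (fin _ (a + a') (fun x hx => ?_) (fun x hx => ?_)))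
    · simp [ha x hx, ha' x hx]
    · simp only [Pi.add_apply, hb x hx, hb' x hx]
      revert e e'; clear * -; revert a b a' b'; decide

/-- connecting cocycle for Mayer–Vietoris. -/
lemma mv_conn {k : ℕ} {Y : Set T} {P Q : Set Z} {φ : List (T × Z) → ZMod 2}
    (h1 : Cob (k + 1) (Y ×ˢ P) φ) (h2 : Cob (k + 1) (Y ×ˢ Q) φ) {q : Z} (hq : q ∈ P ∩ Q) :
    ∃ ψA ψB, LocOn (Y ×ˢ P) (fun l => l.length = k + 2 → φ l = dl ψA l) ∧
      LocOn (Y ×ˢ Q) (fun l => l.length = k + 2 → φ l = dl ψB l) ∧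
      Coc k (Y ×ˢ (P ∩ Q)) (ψA + ψB) ∧ Cob k (Y ×ˢ {q}) (ψA + ψB) := by
  obtain ⟨a, ha⟩ := h1
  obtain ⟨b, hb⟩ := h2
  have res : ∀ {R R' : Set Z} {P : List (T × Z) → Prop}, R' ⊆ R → LocOn (Y ×ˢ R) P →
      LocOn (Y ×ˢ R') P := by
    intro R R' P hR h
    simpa using h.pull (f := id) (A := Y ×ˢ R') continuousOn_id (prod_mono_right hR)
  have hc : Coc k (Y ×ˢ (P ∩ Q)) (a + b) := by
    refine ((res inter_subset_left ha).and (res inter_subset_right hb)).mono ?_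
    rintro l - ⟨e1, e2⟩ hl
    rw [dl_add, ← e1 hl, ← e2 hl, z2]
  have hr : ∀ R : Set Z, Coc k (Y ×ˢ R) (fun l => (a + b) (l.map fun x => (x.1, q))) := fun R =>
    hc.pr (g := fun _ => q) continuousOn_const fun _ _ => hq
  have e : (a + fun l => (a + b) (l.map fun x => (x.1, q))) + b =
      (a + b) + fun l => (a + b) (l.map fun x => (x.1, q)) := by
    rw [add_assoc, add_comm _ b, ← add_assoc]
  refine ⟨a + fun l => (a + b) (l.map fun x => (x.1, q)), b, ?_, hb, ?_, ?_⟩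
  · refine (ha.and (hr P)).mono ?_
    rintro l - ⟨e1, e2⟩ hl
    rw [dl_add, e2 hl, add_zero, e1 hl]
  · rw [e]
    exact hc.add (hr _)
  · rw [e]
    refine Cob.zero.congr fun l hl => ?_
    show (a + b) l + (a + b) (l.map fun x => (x.1, q)) = 0
    rw [list_map_id_on (A := Y ×ˢ {q}) _ hl, z2]
    rintro ⟨y, z⟩ hx
    have : z = q := hx.2
    simp [this]

lemma mv_cob {k : ℕ} {Y : Set T} {S A B : Set Z} (hA : IsClosed A) (hB : IsClosed B)
    (hAB : ∀ x ∈ S, A ∈ 𝓝 x ∨ B ∈ 𝓝 x) {φ ψA ψB : List (T × Z) → ZMod 2}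
    (h1 : LocOn (Y ×ˢ (S ∩ A)) (fun l => l.length = k + 2 → φ l = dl ψA l))
    (h2 : LocOn (Y ×ˢ (S ∩ B)) (fun l => l.length = k + 2 → φ l = dl ψB l))
    (h3 : Cob k (Y ×ˢ (S ∩ A ∩ (S ∩ B))) (ψA + ψB)) : Cob (k + 1) (Y ×ˢ S) φ := by
  have e1 : ∀ S R : Set Z, (Y ×ˢ S) ∩ (univ ×ˢ R) = Y ×ˢ (S ∩ R) := by
    intro S R; ext x; simp only [mem_inter_iff, mem_prod, mem_univ]; tauto
  refine mv_core (A := univ ×ˢ A) (B := univ ×ˢ B) (isClosed_univ.prod hA)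
    (isClosed_univ.prod hB) ?_ (by rwa [e1]) (by rwa [e1]) ?_
  · intro x hx
    rcases hAB x.2 hx.2 with h | h
    · left
      have := prod_mem_nhds (x := x.1) univ_mem h
      exact this
    · right
      have := prod_mem_nhds (x := x.1) univ_mem h
      exact this
  · rw [e1, e1]
    refine h3.restrict (prod_mono_right ?_)
    rintro x ⟨⟨h1, h2⟩, h3⟩
    exact ⟨⟨h1, h2⟩, h1, h3⟩

lemma mv_T {k : ℕ} {Y : Set T} (hY : IsCompact Y) (hYc : IsPreconnected Y)
    {S A B : Set Z} (hA : IsClosed A) (hB : IsClosed B)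
    (hAB : ∀ x ∈ S, A ∈ 𝓝 x ∨ B ∈ 𝓝 x) (hne : (S ∩ A ∩ (S ∩ B)).Nonempty)
    {φ : List (T × Z) → ZMod 2}
    (h1 : Cob (k + 1) (Y ×ˢ (S ∩ A)) φ) (h2 : Cob (k + 1) (Y ×ˢ (S ∩ B)) φ)
    (hQ : RT k (S ∩ A ∩ (S ∩ B)) (S ∩ A ∩ (S ∩ B))) : Cob (k + 1) (Y ×ˢ S) φ := by
  obtain ⟨q, hq⟩ := hne
  obtain ⟨a, b, e1, e2, e3, e4⟩ := mv_conn h1 h2 hq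
  exact mv_cob hA hB hAB e1 e2 (hQ T Y hY hYc _ q hq e3 e4)

lemma RT.mv {k : ℕ} {S A B : Set Z} (hA : IsClosed A) (hB : IsClosed B)
    (hAB : ∀ x ∈ S, A ∈ 𝓝 x ∨ B ∈ 𝓝 x) (hne : (S ∩ A ∩ (S ∩ B)).Nonempty)
    (h1 : RT (k + 1) S (S ∩ A)) (h2 : RT (k + 1) S (S ∩ B))
    (hQ : RT k (S ∩ A ∩ (S ∩ B)) (S ∩ A ∩ (S ∩ B))) : RT (k + 1) S S := by
  intro T _ Y hY hYc φ p hp h hb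
  exact mv_T hY hYc hA hB hAB hne (h1 T Y hY hYc φ p hp h hb) (h2 T Y hY hYc φ p hp h hb) hQ

lemma RO.mv1 {k : ℕ} {S A B : Set Z} (hA : IsClosed A) (hB : IsClosed B)
    (hAB : ∀ x ∈ S, A ∈ 𝓝 x ∨ B ∈ 𝓝 x) (hne : (S ∩ A ∩ (S ∩ B)).Nonempty)
    (h1 : RT (k + 1) S (S ∩ A)) (h2 : RO (k + 1) S (S ∩ B))
    (hQ : RT k (S ∩ A ∩ (S ∩ B)) (S ∩ A ∩ (S ∩ B))) : RO (k + 1) S S := by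
  intro T _ Y hY hYc φ φ' p hp h hb h' hb'
  have k1 := h1 T Y hY hYc φ p hp h hb
  have k2 := h1 T Y hY hYc φ' p hp h' hb'
  rcases h2 T Y hY hYc φ φ' p hp h hb h' hb' with key | key | key
  · exact Or.inl (mv_T hY hYc hA hB hAB hne k1 key hQ)
  · exact Or.inr (Or.inl (mv_T hY hYc hA hB hAB hne k2 key hQ))
  · exact Or.inr (Or.inr (mv_T hY hYc hA hB hAB hne (k1.add k2) key hQ))

lemma RO.mv2 {k : ℕ} {S A B : Set Z} (hA : IsClosed A) (hB : IsClosed B)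
    (hAB : ∀ x ∈ S, A ∈ 𝓝 x ∨ B ∈ 𝓝 x) (hne : (S ∩ A ∩ (S ∩ B)).Nonempty)
    (h1 : RT (k + 1) S (S ∩ A)) (h2 : RT (k + 1) S (S ∩ B))
    (hQ : RO k (S ∩ A ∩ (S ∩ B)) (S ∩ A ∩ (S ∩ B))) : RO (k + 1) S S := by
  intro T _ Y hY hYc φ φ' p hp h hb h' hb'
  obtain ⟨q, hq⟩ := hne
  obtain ⟨a, b, e1, e2, e3, e4⟩ :=
    mv_conn (h1 T Y hY hYc φ p hp h hb) (h2 T Y hY hYc φ p hp h hb) hq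
  obtain ⟨a', b', e1', e2', e3', e4'⟩ :=
    mv_conn (h1 T Y hY hYc φ' p hp h' hb') (h2 T Y hY hYc φ' p hp h' hb') hq
  rcases hQ T Y hY hYc _ _ q hq e3 e4 e3' e4' with key | key | key
  · exact Or.inl (mv_cob hA hB hAB e1 e2 key)
  · exact Or.inr (Or.inl (mv_cob hA hB hAB e1' e2' key))
  · refine Or.inr (Or.inr (mv_cob (ψA := a + a') (ψB := b + b') hA hB hAB ?_ ?_ ?_))
    · refine (e1.and e1').mono ?_
      rintro l - ⟨k1, k2⟩ hl
      rw [dl_add, ← k1 hl, ← k2 hl]; rfl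
    · refine (e2.and e2').mono ?_
      rintro l - ⟨k1, k2⟩ hl
      rw [dl_add, ← k1 hl, ← k2 hl]; rfl
    · rwa [add_add_add_comm]

end
end MPS

namespace MPS
set_option linter.unusedSectionVars false
open Set Topology Filter

/-! ### Spheres -/

/-- normalization -/
noncomputable def nz {V : Type} [NormedAddCommGroup V] [NormedSpace ℝ V] (x : V) : V :=
  ‖x‖⁻¹ • x

section
variable {V W : Type} [NormedAddCommGroup V] [NormedSpace ℝ V]
  [NormedAddCommGroup W] [NormedSpace ℝ W]

lemma nz_mem {x : V} (hx : x ≠ 0) : nz x ∈ Metric.sphere (0 : V) 1 := by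
  simp [nz, norm_smul, hx]

lemma nz_smul {x : V} (hx : x ∈ Metric.sphere (0 : V) 1) {c : ℝ} (hc : 0 < c) :
    nz (c • x) = x := by
  have : ‖x‖ = 1 := by simpa using hx
  rw [nz, norm_smul, this, mul_one, smul_smul, Real.norm_of_nonneg hc.le,
    inv_mul_cancel₀ hc.ne', one_smul]

lemma nz_self {x : V} (hx : x ∈ Metric.sphere (0 : V) 1) : nz x = x := by
  simpa using nz_smul hx one_pos

lemma sphere_ne {x : V} (hx : x ∈ Metric.sphere (0 : V) 1) : x ≠ 0 := by
  rintro rfl; simp at hx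

lemma nz_contOn {X : Type} [TopologicalSpace X] {f : X → V} {A : Set X} (hf : ContinuousOn f A)
    (h : ∀ x ∈ A, f x ≠ 0) : ContinuousOn (fun x => nz (f x)) A :=
  (hf.norm.inv₀ fun x hx => norm_ne_zero_iff.2 (h x hx)).smul hf

lemma sphere_pc [FiniteDimensional ℝ V] (h : 2 ≤ Module.finrank ℝ V) :
    IsPathConnected (Metric.sphere (0 : V) 1) := by
  apply isPathConnected_sphere _ _ zero_le_one
  rw [← Module.finrank_eq_rank]
  exact_mod_cast h

lemma RT.cap {k : ℕ} (hpc : IsPathConnected (Metric.sphere (0 : V) 1))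
    {A : Set V} (hA : IsCompact A) (hAS : A ⊆ Metric.sphere (0 : V) 1) {u : V}
    (hu : u ∈ Metric.sphere (0 : V) 1) (huA : -u ∉ A) : RT k (Metric.sphere (0 : V) 1) A := by
  have hu1 : ‖u‖ = 1 := by simpa using hu
  have key : ∀ t ∈ Icc (0:ℝ) 1, ∀ x ∈ A, (1 - t) • u + t • x ≠ 0 := by
    intro t ht x hx h
    have hx1 : ‖x‖ = 1 := by simpa using hAS hx
    have h1 : (1 - t) • u = - (t • x) := eq_neg_of_add_eq_zero_left h
    have h2 := congrArg norm h1
    rw [norm_neg, norm_smul, norm_smul, hu1, hx1, Real.norm_of_nonneg (by linarith [ht.2]),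
      Real.norm_of_nonneg ht.1] at h2
    have h3 : t = 1/2 := by linarith
    subst h3
    apply huA
    have : x = -u := by
      have h4 : (1/2 : ℝ) • (u + x) = 0 := by
        rw [smul_add, ← h]; norm_num
      have h5 : u + x = 0 := (smul_eq_zero.1 h4).resolve_left (by norm_num)
      exact eq_neg_of_add_eq_zero_right h5
    rwa [← this]
  refine RT.deform (RT.point u) hA (f := fun _ => u) (g := id) continuousOn_const continuousOn_id
    (fun _ _ => rfl) (by rintro x hx; rw [mem_singleton_iff.1 hx]; exact hu)
    (fun t x => nz ((1 - t) • u + t • x)) ?_ ?_ ?_ ?_ ?_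
  · apply nz_contOn
    · fun_prop
    · exact fun p hp => key p.1 hp.1 p.2 hp.2
  · exact fun t ht x hx => nz_mem (key t ht x hx)
  · intro x hx
    simpa using nz_self (hAS hx)
  · intro x hx
    simpa using nz_self hu
  · exact fun p hp => ⟨u, rfl, hpc.joinedIn p hp u hu⟩

/-- spheres of linearly equivalent spaces are homeomorphic -/
lemma equiv_sphere (e : V ≃L[ℝ] W) :
    ContinuousOn (fun x => nz (e x)) (Metric.sphere (0 : V) 1) ∧
    MapsTo (fun x => nz (e x)) (Metric.sphere (0 : V) 1) (Metric.sphere (0 : W) 1) ∧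
    ∀ x ∈ Metric.sphere (0 : V) 1, nz (e.symm (nz (e x))) = x := by
  refine ⟨nz_contOn e.continuous.continuousOn fun x hx => ?_, fun x hx => nz_mem ?_, ?_⟩
  · simpa using sphere_ne hx
  · simpa using sphere_ne hx
  · intro x hx
    have : e x ≠ 0 := by simpa using sphere_ne hx
    rw [show nz (e x) = ‖e x‖⁻¹ • e x from rfl, map_smul, e.symm_apply_apply]
    exact nz_smul hx (by positivity)

lemma RT.equiv {k : ℕ} (e : V ≃L[ℝ] W)
    (h : RT k (Metric.sphere (0 : W) 1) (Metric.sphere (0 : W) 1)) :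
    RT k (Metric.sphere (0 : V) 1) (Metric.sphere (0 : V) 1) :=
  h.transport (equiv_sphere e).1 (equiv_sphere e.symm).1 (equiv_sphere e).2.1
    (equiv_sphere e.symm).2.1 (equiv_sphere e).2.2

lemma RO.equiv {k : ℕ} (e : V ≃L[ℝ] W)
    (h : RO k (Metric.sphere (0 : W) 1) (Metric.sphere (0 : W) 1)) :
    RO k (Metric.sphere (0 : V) 1) (Metric.sphere (0 : V) 1) :=
  h.transport (equiv_sphere e).1 (equiv_sphere e.symm).1 (equiv_sphere e).2.1
    (equiv_sphere e.symm).2.1 (equiv_sphere e).2.2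

/-- upper part -/
def capA (W : Type) : Set (ℝ × W) := {x | -(1/2) ≤ x.1}
/-- lower part -/
def capB (W : Type) : Set (ℝ × W) := {x | x.1 ≤ 1/2}

lemma capA_closed : IsClosed (capA W) := isClosed_le continuous_const continuous_fst
lemma capB_closed : IsClosed (capB W) := isClosed_le continuous_fst continuous_const

lemma cap_cover (x : ℝ × W) : capA W ∈ 𝓝 x ∨ capB W ∈ 𝓝 x := by
  rcases le_total 0 x.1 with h | h
  · left
    have : {y : ℝ × W | -(1/2) < y.1} ∈ 𝓝 x :=
      (isOpen_lt continuous_const continuous_fst).mem_nhds (by simp only [mem_ofPred_eq]; linarith)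
    exact mem_of_superset this fun y hy => le_of_lt (show -(1/2) < y.1 from hy)
  · right
    have : {y : ℝ × W | y.1 < 1/2} ∈ 𝓝 x :=
      (isOpen_lt continuous_fst continuous_const).mem_nhds (by simp only [mem_ofPred_eq]; linarith)
    exact mem_of_superset this fun y hy => le_of_lt (show y.1 < 1/2 from hy)

lemma capQ : Metric.sphere (0 : ℝ × W) 1 ∩ capA W ∩ (Metric.sphere (0 : ℝ × W) 1 ∩ capB W) =
    Icc (-(1/2) : ℝ) (1/2) ×ˢ Metric.sphere (0 : W) 1 := by
  ext ⟨a, w⟩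
  simp only [capA, capB, mem_inter_iff, mem_sphere_zero_iff_norm, Prod.norm_mk, mem_ofPred_eq,
    mem_prod, mem_Icc, Real.norm_eq_abs]
  constructor
  · rintro ⟨⟨h1, h2⟩, -, h3⟩
    refine ⟨⟨h2, h3⟩, ?_⟩
    have : |a| ≤ 1/2 := abs_le.2 ⟨h2, h3⟩
    rcases max_choice |a| ‖w‖ with h | h
    · rw [h] at h1; linarith
    · rw [h] at h1; exact h1
  · rintro ⟨⟨h1, h2⟩, h3⟩
    have : |a| ≤ 1/2 := abs_le.2 ⟨h1, h2⟩
    have h4 : max |a| ‖w‖ = 1 := by rw [h3, max_eq_right]; linarith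
    exact ⟨⟨h4, h1⟩, h4, h2⟩

lemma RT.capA {k : ℕ} [FiniteDimensional ℝ W] (h : 1 ≤ Module.finrank ℝ W) :
    RT k (Metric.sphere (0 : ℝ × W) 1) (Metric.sphere (0 : ℝ × W) 1 ∩ capA W) ∧
    RT k (Metric.sphere (0 : ℝ × W) 1) (Metric.sphere (0 : ℝ × W) 1 ∩ capB W) := by
  have hpc : IsPathConnected (Metric.sphere (0 : ℝ × W) 1) := sphere_pc (by
    rw [Module.finrank_prod, Module.finrank_self]; omega)
  have : ProperSpace (ℝ × W) := FiniteDimensional.proper_real _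
  constructor
  · refine RT.cap hpc ((isCompact_sphere _ _).inter_right capA_closed) inter_subset_left
      (u := ((1:ℝ), (0:W))) (by simp [Prod.norm_def]) ?_
    rintro ⟨-, h⟩
    simp [MPS.capA] at h
    norm_num at h
  · refine RT.cap hpc ((isCompact_sphere _ _).inter_right capB_closed) inter_subset_left
      (u := ((-1:ℝ), (0:W))) (by simp [Prod.norm_def]) ?_
    rintro ⟨-, h⟩
    simp [MPS.capB] at h
    norm_num at h

lemma RT.susp {k : ℕ} [FiniteDimensional ℝ W] (hW : 1 ≤ Module.finrank ℝ W)
    (h : RT k (Metric.sphere (0 : W) 1) (Metric.sphere (0 : W) 1)) :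
    RT (k + 1) (Metric.sphere (0 : ℝ × W) 1) (Metric.sphere (0 : ℝ × W) 1) := by
  have hN : Nontrivial W := Module.nontrivial_of_finrank_pos (R := ℝ) (by omega)
  obtain ⟨w, hw⟩ := exists_norm_eq W zero_le_one
  have : ProperSpace W := FiniteDimensional.proper_real _
  refine RT.mv capA_closed capB_closed (fun x _ => cap_cover x) ?_ (RT.capA hW).1
    (RT.capA hW).2 ?_
  · rw [capQ]
    exact ⟨(0, w), by norm_num, by simpa using hw⟩
  · rw [capQ]
    have hF : ∀ t ∈ Icc (0:ℝ) 1, ∀ x ∈ Icc (-(1/2) : ℝ) (1/2) ×ˢ Metric.sphere (0 : W) 1,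
        (t * x.1, x.2) ∈ Icc (-(1/2) : ℝ) (1/2) ×ˢ Metric.sphere (0 : W) 1 := by
      rintro t ⟨ht0, ht1⟩ x ⟨⟨hx1, hx2⟩, hx⟩
      refine ⟨⟨?_, ?_⟩, hx⟩ <;> dsimp only <;> nlinarith
    refine RT.deform h (isCompact_Icc.prod (isCompact_sphere _ _)) (f := Prod.snd)
      (g := fun w => ((0:ℝ), w)) continuousOn_snd (by fun_prop) (fun x hx => hx.2)
      (fun x hx => ⟨by norm_num, hx⟩) (fun t x => (t * x.1, x.2)) (by fun_prop) hF
      (by simp) (by simp) ?_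
    intro p hp
    refine ⟨p.2, hp.2, JoinedIn.symm ?_⟩
    refine JoinedIn.ofLine (f := fun t : ℝ => (t * p.1, p.2)) (by fun_prop) (by simp) (by simp) ?_
    rintro _ ⟨t, ht, rfl⟩
    exact hF t ht p hp

end

theorem sphere_RT (k : ℕ) : ∀ (V : Type) [NormedAddCommGroup V] [NormedSpace ℝ V]
    [FiniteDimensional ℝ V], k + 2 ≤ Module.finrank ℝ V →
    RT k (Metric.sphere (0 : V) 1) (Metric.sphere (0 : V) 1) := by
  induction k with
  | zero =>
    intro V _ _ _ h
    exact RT.zero (sphere_pc h).isConnected.isPreconnected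
  | succ k ih =>
    intro V _ _ _ h
    obtain ⟨n, hn⟩ : ∃ n, Module.finrank ℝ V = n + 1 := ⟨Module.finrank ℝ V - 1, by omega⟩
    have hfin : Module.finrank ℝ (Fin n → ℝ) = n := by simp
    have e : V ≃L[ℝ] (ℝ × (Fin n → ℝ)) := ContinuousLinearEquiv.ofFinrankEq (by
      rw [Module.finrank_prod, Module.finrank_self, hn, hfin, add_comm])
    refine RT.equiv e (RT.susp (by omega) (ih _ (by omega)))

theorem circle_RO (V : Type) [NormedAddCommGroup V] [NormedSpace ℝ V]
    [FiniteDimensional ℝ V] (h : Module.finrank ℝ V = 2) :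
    RO 1 (Metric.sphere (0 : V) 1) (Metric.sphere (0 : V) 1) := by
  have e : V ≃L[ℝ] (ℝ × ℝ) := ContinuousLinearEquiv.ofFinrankEq (by
      rw [Module.finrank_prod, Module.finrank_self, h])
  refine RO.equiv e (RO.mv2 capA_closed capB_closed (fun x _ => cap_cover x) ?_
    (RT.capA (by simp)).1 (RT.capA (by simp)).2 ?_)
  · rw [capQ]
    exact ⟨(0, 1), by norm_num, by simp⟩
  · rw [capQ]
    refine RO.zero (S₁ := Icc (-(1/2) : ℝ) (1/2) ×ˢ {(1:ℝ)})
      (S₂ := Icc (-(1/2) : ℝ) (1/2) ×ˢ {(-1:ℝ)}) ?_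
      (isPreconnected_Icc.prod isPreconnected_singleton)
      (isPreconnected_Icc.prod isPreconnected_singleton)
    ext ⟨a, b⟩
    simp only [mem_prod, mem_union, mem_singleton_iff, mem_sphere_zero_iff_norm,
      Real.norm_eq_abs, abs_eq (zero_le_one' ℝ)]
    tauto

end MPS

namespace MPS
set_option linter.unusedSectionVars false
open Set Topology Filter

/-! ### Complex projective space -/

/-- homogeneous coordinates -/
abbrev VV (m : ℕ) := Fin (m + 1) → ℂ
/-- complex projective space -/
abbrev CP (m : ℕ) := Projectivization ℂ (VV m)

open Classical in
/-- the projection, with a junk value at zero -/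
noncomputable def toP {m : ℕ} (v : VV m) : CP m :=
  if h : v ≠ 0 then Projectivization.mk ℂ v h else Projectivization.mk ℂ (fun _ => 1) (by
    intro h; have := congrFun h 0; simp at this)

section
variable {m : ℕ}

lemma toP_of_ne {v : VV m} (h : v ≠ 0) : toP v = Projectivization.mk ℂ v h := by
  simp [toP, h]

lemma toP_rep (p : CP m) : toP p.rep = p := by
  rw [toP_of_ne p.rep_nonzero, Projectivization.mk_rep]

lemma toP_smul {v : VV m} {a : ℂ} (ha : a ≠ 0) : toP (a • v) = toP v := by
  by_cases hv : v = 0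
  · simp [hv]
  · have h : a • v ≠ 0 := smul_ne_zero ha hv
    rw [toP_of_ne hv, toP_of_ne h, Projectivization.mk_eq_mk_iff']
    exact ⟨a, rfl⟩

lemma rep_toP {v : VV m} (h : v ≠ 0) : ∃ a : ℂ, a ≠ 0 ∧ (toP v).rep = a • v := by
  rw [toP_of_ne h]
  obtain ⟨a, ha⟩ := Projectivization.exists_smul_eq_mk_rep ℂ v h
  exact ⟨a, a.ne_zero, ha.symm⟩

lemma toP_eq {v w : VV m} (hv : v ≠ 0) (hw : w ≠ 0) (h : toP v = toP w) :
    ∃ a : ℂ, a ≠ 0 ∧ v = a • w := by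
  rw [toP_of_ne hv, toP_of_ne hw, Projectivization.mk_eq_mk_iff] at h
  obtain ⟨a, ha⟩ := h
  exact ⟨a, a.ne_zero, ha.symm⟩

lemma cont_sub : Continuous (fun v : {v : VV m // v ≠ 0} => toP v.1) := by
  have : (fun v : {v : VV m // v ≠ 0} => toP v.1) =
      (Quotient.mk (projectivizationSetoid ℂ (VV m)) : _ → CP m) := by
    funext v
    exact toP_of_ne v.2
  rw [this]
  exact continuous_quotient_mk'

lemma isOpen_CP {U : Set (CP m)} (h : IsOpen {v : VV m | v ≠ 0 ∧ toP v ∈ U}) : IsOpen U := by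
  have : IsOpen ((Quotient.mk (projectivizationSetoid ℂ (VV m)) : _ → CP m) ⁻¹' U) := by
    have h2 := h.preimage (continuous_subtype_val : Continuous (Subtype.val : {v : VV m // v ≠ 0} → VV m))
    convert h2 using 1
    ext v
    simp only [mem_preimage, mem_ofPred_eq]
    rw [toP_of_ne v.2]
    exact ⟨fun h => ⟨v.2, h⟩, fun h => h.2⟩
  exact isOpen_coinduced.2 this

lemma nhds_toP {v : VV m} (hv : v ≠ 0) : 𝓝 (toP v) = map toP (𝓝 v) := by
  apply le_antisymm
  · intro U hU
    rw [mem_map] at hU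
    obtain ⟨O, hO, hOo, hvO⟩ := mem_nhds_iff.1 hU
    let O' := O ∩ {w : VV m | w ≠ 0}
    have hO' : IsOpen O' := hOo.inter isOpen_ne
    have : IsOpen (toP '' O') := by
      apply isOpen_CP
      have : {v : VV m | v ≠ 0 ∧ toP v ∈ toP '' O'} =
          ⋃ a : {a : ℂ // a ≠ 0}, (fun w => a.1 • w) ⁻¹' O' := by
        ext w
        simp only [mem_ofPred_eq, mem_iUnion, mem_preimage]
        constructor
        · rintro ⟨hw, u, hu, e⟩
          obtain ⟨a, ha, e⟩ := toP_eq hu.2 hw e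
          exact ⟨⟨a, ha⟩, e ▸ hu⟩
        · rintro ⟨⟨a, ha⟩, h⟩
          refine ⟨?_, _, h, toP_smul ha⟩
          rintro rfl
          exact h.2 (smul_zero _)
      rw [this]
      exact isOpen_iUnion fun a => hO'.preimage (by fun_prop)
    refine mem_of_superset (this.mem_nhds ⟨v, ⟨hvO, hv⟩, rfl⟩) ?_
    rintro _ ⟨w, hw, rfl⟩
    exact hO hw.1
  · have := cont_sub.continuousAt (x := (⟨v, hv⟩ : {v : VV m // v ≠ 0}))
    rw [ContinuousAt, nhds_subtype_eq_comap] at this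
    have h2 : map toP (map Subtype.val (comap (Subtype.val : {v : VV m // v ≠ 0} → VV m) (𝓝 v)))
        ≤ 𝓝 (toP v) := by
      rw [map_map]; exact this
    rwa [Filter.map_comap_of_mem] at h2
    have e : range (Subtype.val : {v : VV m // v ≠ 0} → VV m) = {v | v ≠ 0} := Subtype.range_coe
    exact e ▸ isOpen_ne.mem_nhds hv

lemma toP_contAt {v : VV m} (hv : v ≠ 0) : ContinuousAt toP v := (nhds_toP hv).ge

lemma toP_contOn {X : Type} [TopologicalSpace X] {f : X → VV m} {A : Set X}
    (hf : ContinuousOn f A) (h : ∀ x ∈ A, f x ≠ 0) : ContinuousOn (fun x => toP (f x)) A :=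
  fun x hx => (toP_contAt (h x hx)).comp_continuousWithinAt (hf x hx)

lemma contAt_lift {X : Type} [TopologicalSpace X] {G : CP m → X} {g : VV m → X} {p : CP m}
    (h : ∀ v : VV m, v ≠ 0 → G (toP v) = g v) (hg : ContinuousAt g p.rep) : ContinuousAt G p := by
  conv => rw [← toP_rep p]
  rw [ContinuousAt, nhds_toP p.rep_nonzero, tendsto_map'_iff, h _ p.rep_nonzero]
  refine hg.tendsto.congr' ?_
  filter_upwards [isOpen_ne.mem_nhds p.rep_nonzero] with v hv using (h v hv).symm

lemma contAt_lift2 {T X : Type} [TopologicalSpace T] [TopologicalSpace X]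
    {G : T × CP m → X} {g : T × VV m → X} {t : T} {p : CP m}
    (h : ∀ t, ∀ v : VV m, v ≠ 0 → G (t, toP v) = g (t, v))
    (hg : ContinuousAt g (t, p.rep)) : ContinuousAt G (t, p) := by
  conv => rw [← toP_rep p]
  rw [ContinuousAt, nhds_prod_eq, nhds_toP p.rep_nonzero, ← Filter.map_id (f := 𝓝 t),
    Filter.prod_map_map_eq, tendsto_map'_iff, h _ _ p.rep_nonzero, ← nhds_prod_eq]
  refine hg.tendsto.congr' ?_
  have : {x : T × VV m | x.2 ≠ 0} ∈ 𝓝 (t, p.rep) :=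
    (isOpen_ne.preimage continuous_snd).mem_nhds p.rep_nonzero
  filter_upwards [this] with v hv using (h v.1 v.2 hv).symm

lemma finrank_VV (n : ℕ) : Module.finrank ℝ (Fin n → ℂ) = 2 * n := by
  rw [Module.finrank_pi_fintype]; simp [Complex.finrank_real_complex, mul_comm]

lemma toP_surj (p : CP m) : ∃ v : VV m, v ∈ Metric.sphere (0 : VV m) 1 ∧ toP v = p := by
  refine ⟨nz p.rep, nz_mem p.rep_nonzero, ?_⟩
  have h : ‖p.rep‖ ≠ 0 := norm_ne_zero_iff.2 p.rep_nonzero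
  have : nz p.rep = ((‖p.rep‖⁻¹ : ℝ) : ℂ) • p.rep := by
    rw [nz]; exact (RCLike.real_smul_eq_coe_smul (K := ℂ) _ _)
  rw [this, toP_smul (by exact_mod_cast inv_ne_zero h), toP_rep]

instance : CompactSpace (CP m) := by
  constructor
  have h : ContinuousOn (toP (m := m)) (Metric.sphere 0 1) :=
    toP_contOn continuousOn_id fun x hx => sphere_ne hx
  have := (isCompact_sphere (0 : VV m) 1).image_of_continuousOn h
  convert this
  symm
  rw [eq_univ_iff_forall]
  intro p
  obtain ⟨v, hv, e⟩ := toP_surj p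
  exact ⟨v, hv, e⟩

instance : PathConnectedSpace (CP m) := by
  rw [pathConnectedSpace_iff_univ]
  have h : ContinuousOn (toP (m := m)) (Metric.sphere 0 1) :=
    toP_contOn continuousOn_id fun x hx => sphere_ne hx
  have := (sphere_pc (V := VV m) (by rw [finrank_VV]; omega)).image' h
  convert this
  symm
  rw [eq_univ_iff_forall]
  intro p
  obtain ⟨v, hv, e⟩ := toP_surj p
  exact ⟨v, hv, e⟩

instance : Subsingleton (CP 0) := by
  constructor
  intro p q
  have : Subsingleton (Fin (0 + 1)) := inferInstanceAs (Subsingleton (Fin 1))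
  rw [← toP_rep p, ← toP_rep q]
  have h : ∀ p : CP 0, p.rep 0 ≠ 0 := by
    intro p hp
    apply p.rep_nonzero
    funext i
    rw [Subsingleton.elim i 0, hp]; rfl
  have : p.rep = (p.rep 0 / q.rep 0) • q.rep := by
    funext i
    rw [Subsingleton.elim i 0]
    simp [h q]
  rw [this, toP_smul (div_ne_zero (h p) (h q))]

end

lemma RT.ro {k : ℕ} {Z : Type} [TopologicalSpace Z] {S A : Set Z} (h : RT k S A) : RO k S A :=
  fun T _ Y hY hYc φ _ p hp h1 hb1 _ _ => Or.inl (h T Y hY hYc φ p hp h1 hb1)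

section
variable {m : ℕ}

/-- the last coordinates -/
def tl (v : VV (m + 1)) : VV m := fun i => v i.succ
/-- adding a coordinate -/
def cn (a : ℂ) (w : VV m) : VV (m + 1) := Fin.cons a w

@[simp] lemma cn_zero (a : ℂ) (w : VV m) : cn a w 0 = a := rfl
@[simp] lemma tl_cn (a : ℂ) (w : VV m) : tl (cn a w) = w := by
  funext i; simp [tl, cn]
lemma cn_tl (v : VV (m + 1)) : cn (v 0) (tl v) = v := by
  funext i; refine Fin.cases ?_ (fun i => ?_) i <;> simp [tl, cn]
lemma smul_cn (c a : ℂ) (w : VV m) : c • cn a w = cn (c * a) (c • w) := by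
  funext i; refine Fin.cases ?_ (fun i => ?_) i <;> simp [cn]
lemma tl_smul (c : ℂ) (v : VV (m + 1)) : tl (c • v) = c • tl v := rfl
lemma cn_ne_left {a : ℂ} (h : a ≠ 0) (w : VV m) : cn a w ≠ 0 := fun e => h (by
  have := congrFun e 0; simpa using this)
lemma cn_ne_right (a : ℂ) {w : VV m} (h : w ≠ 0) : cn a w ≠ 0 := fun e => h (by
  rw [← tl_cn a w, e]; rfl)

lemma tl_cont : Continuous (tl (m := m)) := continuous_pi fun i => continuous_apply _
lemma cn_cont : Continuous (fun x : ℂ × VV m => cn x.1 x.2) := by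
  apply continuous_pi
  intro i
  refine Fin.cases ?_ (fun i => ?_) i
  · simpa using continuous_fst
  · have : Continuous fun x : ℂ × VV m => x.2 i := by fun_prop
    simpa [cn] using this

/-- size of the first coordinate -/
noncomputable def sa (p : CP (m + 1)) : ℝ := ‖p.rep 0‖ / ‖p.rep‖
/-- size of the last coordinates -/
noncomputable def sb (p : CP (m + 1)) : ℝ := ‖tl p.rep‖ / ‖p.rep‖

lemma sa_toP {v : VV (m + 1)} (hv : v ≠ 0) : sa (toP v) = ‖v 0‖ / ‖v‖ := by
  obtain ⟨a, ha, e⟩ := rep_toP hv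
  rw [sa, e, norm_smul, Pi.smul_apply, norm_smul, mul_div_mul_left _ _ (norm_ne_zero_iff.2 ha)]
lemma sb_toP {v : VV (m + 1)} (hv : v ≠ 0) : sb (toP v) = ‖tl v‖ / ‖v‖ := by
  obtain ⟨a, ha, e⟩ := rep_toP hv
  rw [sb, e, norm_smul, tl_smul, norm_smul, mul_div_mul_left _ _ (norm_ne_zero_iff.2 ha)]

lemma sa_cont : Continuous (sa (m := m)) := by
  rw [continuous_iff_continuousAt]
  intro p
  refine contAt_lift (g := fun v : VV (m + 1) => ‖v 0‖ / ‖v‖) (fun v hv => sa_toP hv) ?_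
  have := norm_ne_zero_iff.2 p.rep_nonzero
  fun_prop (disch := assumption)
lemma sb_cont : Continuous (sb (m := m)) := by
  rw [continuous_iff_continuousAt]
  intro p
  refine contAt_lift (g := fun v : VV (m + 1) => ‖tl v‖ / ‖v‖) (fun v hv => sb_toP hv) ?_
  have := norm_ne_zero_iff.2 p.rep_nonzero
  have h2 := tl_cont (m := m)
  fun_prop (disch := assumption)

/-- first piece -/
def pA (m : ℕ) : Set (CP (m + 1)) := {p | sb p ≤ 2 * sa p}
/-- second piece -/
def pB (m : ℕ) : Set (CP (m + 1)) := {p | sa p ≤ sb p}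

lemma pA_closed : IsClosed (pA m) := isClosed_le sb_cont (continuous_const.mul sa_cont)
lemma pB_closed : IsClosed (pB m) := isClosed_le sa_cont sb_cont

lemma toP_pA {v : VV (m + 1)} (hv : v ≠ 0) : toP v ∈ pA m ↔ ‖tl v‖ ≤ 2 * ‖v 0‖ := by
  have := norm_pos_iff.2 hv
  rw [pA, mem_ofPred_eq, sa_toP hv, sb_toP hv, ← mul_div_assoc, div_le_div_iff_of_pos_right this]
lemma toP_pB {v : VV (m + 1)} (hv : v ≠ 0) : toP v ∈ pB m ↔ ‖v 0‖ ≤ ‖tl v‖ := by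
  have := norm_pos_iff.2 hv
  rw [pB, mem_ofPred_eq, sa_toP hv, sb_toP hv, div_le_div_iff_of_pos_right this]

lemma sab (p : CP (m + 1)) : 0 < sa p ∨ 0 < sb p := by
  have h := norm_pos_iff.2 p.rep_nonzero
  by_cases h0 : p.rep 0 = 0
  · right
    refine div_pos (norm_pos_iff.2 fun h1 => p.rep_nonzero ?_) h
    rw [← cn_tl p.rep, h0, h1]
    funext i; refine Fin.cases ?_ (fun i => ?_) i <;> simp [cn]
  · exact Or.inl (div_pos (norm_pos_iff.2 h0) h)

lemma p_cover (p : CP (m + 1)) : pA m ∈ 𝓝 p ∨ pB m ∈ 𝓝 p := by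
  have h0 : 0 ≤ sa p := by unfold sa; positivity
  by_cases h : sb p < 2 * sa p
  · left
    have : {y : CP (m + 1) | sb y < 2 * sa y} ∈ 𝓝 p :=
      (isOpen_lt sb_cont (continuous_const.mul sa_cont)).mem_nhds h
    exact mem_of_superset this fun y hy => le_of_lt (show sb y < 2 * sa y from hy)
  · right
    have : {y : CP (m + 1) | sa y < sb y} ∈ 𝓝 p :=
      (isOpen_lt sa_cont sb_cont).mem_nhds (by
        show sa p < sb p
        rcases sab p with h | h <;> linarith)
    exact mem_of_superset this fun y hy => le_of_lt (show sa y < sb y from hy)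

lemma pA_ne {p : CP (m + 1)} (hp : p ∈ pA m) : p.rep 0 ≠ 0 := by
  intro h
  have hp' : sb p ≤ 2 * sa p := hp
  have : sa p = 0 := by simp [sa, h]
  rcases sab p with h | h <;> linarith
lemma pB_ne {p : CP (m + 1)} (hp : p ∈ pB m) : tl p.rep ≠ 0 := by
  intro h
  have hp' : sa p ≤ sb p := hp
  have : sb p = 0 := by simp [sb, h]
  rcases sab p with h | h <;> linarith

lemma RT_pA {k : ℕ} : RT k (univ : Set (CP (m + 1))) (univ ∩ pA m) := by
  rw [univ_inter]
  refine RT.deform (RT.point (toP (cn 1 (0 : VV m)))) pA_closed.isCompact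
    (f := fun _ => toP (cn 1 0)) (g := id)
    continuousOn_const continuousOn_id (fun _ _ => rfl) (fun _ _ => mem_univ _)
    (fun t p => toP (cn (p.rep 0) ((t : ℂ) • tl p.rep))) ?_ ?_ ?_ ?_ ?_
  · rintro ⟨t, p⟩ ⟨-, hp⟩
    apply ContinuousAt.continuousWithinAt
    refine contAt_lift2 (G := fun x : ℝ × CP (m + 1) => toP (cn (x.2.rep 0) ((x.1 : ℂ) • tl x.2.rep)))
      (g := fun x : ℝ × VV (m + 1) => toP (cn (x.2 0) ((x.1 : ℂ) • tl x.2)))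
      ?_ ?_
    · intro t v hv
      obtain ⟨a, ha, e⟩ := rep_toP hv
      dsimp only
      rw [e, tl_smul, smul_comm, Pi.smul_apply, smul_eq_mul, ← smul_cn, toP_smul ha]
    · refine ContinuousAt.comp (g := toP) (toP_contAt (cn_ne_left (pA_ne hp) _)) ?_
      apply Continuous.continuousAt
      have := tl_cont (m := m)
      exact cn_cont.comp (f := fun x : ℝ × VV (m + 1) => (x.2 0, (x.1 : ℂ) • tl x.2)) (by fun_prop)
  · exact fun _ _ _ _ => mem_univ _
  · intro p _
    simp [cn_tl, toP_rep]
  · intro p hp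
    have := toP_smul (v := cn 1 (0 : VV m)) (pA_ne hp)
    rw [smul_cn] at this
    simpa using this
  · intro p hp
    exact ⟨_, rfl, by simpa using PathConnectedSpace.joined p _⟩

lemma pB_data : ContinuousOn (fun p : CP (m + 1) => toP (tl p.rep)) (pB m) ∧
    Continuous (fun q : CP m => toP (cn 0 q.rep)) ∧
    ContinuousOn (fun x : ℝ × CP (m + 1) => toP (cn ((x.1 : ℂ) * x.2.rep 0) (tl x.2.rep)))
      (Icc (0:ℝ) 1 ×ˢ pB m) ∧
    ∀ p ∈ pB m, toP (cn 0 (tl p.rep)) = toP (cn 0 (toP (tl p.rep)).rep) := by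
  refine ⟨fun p hp => ?_, ?_, ?_, ?_⟩
  · apply ContinuousAt.continuousWithinAt
    refine contAt_lift (g := fun v : VV (m + 1) => toP (tl v)) ?_ ?_
    · intro v hv
      obtain ⟨a, ha, e⟩ := rep_toP hv
      rw [e, tl_smul, toP_smul ha]
    · exact ContinuousAt.comp (g := toP) (toP_contAt (pB_ne hp)) tl_cont.continuousAt
  · rw [continuous_iff_continuousAt]
    intro q
    refine contAt_lift (g := fun v : VV m => toP (cn 0 v)) ?_ ?_
    · intro v hv
      obtain ⟨a, ha, e⟩ := rep_toP hv
      rw [e, ← toP_smul ha (v := cn 0 v), smul_cn, mul_zero]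
    · refine ContinuousAt.comp (g := toP) (toP_contAt (cn_ne_right _ q.rep_nonzero)) ?_
      exact (cn_cont.comp (f := fun x : VV m => ((0:ℂ), x)) (by fun_prop)).continuousAt
  · rintro ⟨t, p⟩ ⟨-, hp⟩
    apply ContinuousAt.continuousWithinAt
    refine contAt_lift2 (g := fun x : ℝ × VV (m + 1) => toP (cn ((x.1 : ℂ) * x.2 0) (tl x.2)))
      ?_ ?_
    · intro t v hv
      obtain ⟨a, ha, e⟩ := rep_toP hv
      dsimp only
      rw [e, tl_smul, Pi.smul_apply, smul_eq_mul, mul_left_comm, ← smul_cn, toP_smul ha]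
    · refine ContinuousAt.comp (g := toP) (toP_contAt (cn_ne_right _ (pB_ne hp))) ?_
      apply Continuous.continuousAt
      have := tl_cont (m := m)
      exact cn_cont.comp (f := fun x : ℝ × VV (m + 1) => ((x.1 : ℂ) * x.2 0, tl x.2))
        (by fun_prop)
  · intro p hp
    obtain ⟨a, ha, e⟩ := rep_toP (pB_ne hp)
    rw [e, ← toP_smul ha, smul_cn, mul_zero]

lemma RO_pB {k : ℕ} (h : RO k (univ : Set (CP m)) univ) :
    RO k (univ : Set (CP (m + 1))) (univ ∩ pB m) := by
  rw [univ_inter]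
  refine RO.deform h pB_closed.isCompact pB_data.1 pB_data.2.1.continuousOn (fun _ _ => mem_univ _)
    (fun _ _ => mem_univ _) (fun t p => toP (cn ((t : ℂ) * p.rep 0) (tl p.rep))) pB_data.2.2.1
    (fun _ _ _ _ => mem_univ _) ?_ ?_ ?_
  · intro p _
    simp [cn_tl, toP_rep]
  · intro p hp
    simpa using pB_data.2.2.2 p hp
  · intro p hp
    exact ⟨toP 0, mem_univ _, by simpa using PathConnectedSpace.joined p _⟩

lemma RT_pB {k : ℕ} (h : RT k (univ : Set (CP m)) univ) :
    RT k (univ : Set (CP (m + 1))) (univ ∩ pB m) := by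
  rw [univ_inter]
  refine RT.deform h pB_closed.isCompact pB_data.1 pB_data.2.1.continuousOn (fun _ _ => mem_univ _)
    (fun _ _ => mem_univ _) (fun t p => toP (cn ((t : ℂ) * p.rep 0) (tl p.rep))) pB_data.2.2.1
    (fun _ _ _ _ => mem_univ _) ?_ ?_ ?_
  · intro p _
    simp [cn_tl, toP_rep]
  · intro p hp
    simpa using pB_data.2.2.2 p hp
  · intro p hp
    exact ⟨toP 0, mem_univ _, by simpa using PathConnectedSpace.joined p _⟩

/-- affine coordinate -/
noncomputable def aff (p : CP (m + 1)) : VV m := (p.rep 0)⁻¹ • tl p.rep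

lemma aff_toP {v : VV (m + 1)} (hv : v ≠ 0) : aff (toP v) = (v 0)⁻¹ • tl v := by
  obtain ⟨a, ha, e⟩ := rep_toP hv
  rw [aff, e, tl_smul, smul_smul, Pi.smul_apply, smul_eq_mul]
  congr 1
  field_simp

lemma aff_contOn : ContinuousOn (aff (m := m)) (pA m) := by
  intro p hp
  apply ContinuousAt.continuousWithinAt
  refine contAt_lift (g := fun v : VV (m + 1) => (v 0)⁻¹ • tl v) (fun v hv => aff_toP hv) ?_
  have h := pA_ne hp
  exact ContinuousAt.smul (ContinuousAt.inv₀ (continuous_apply (0 : Fin (m + 1 + 1))).continuousAt h) tl_cont.continuousAt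

lemma toP_cn_aff {p : CP (m + 1)} (hp : p ∈ pA m) : toP (cn 1 (aff p)) = p := by
  rw [← toP_smul (pA_ne hp), smul_cn, mul_one, aff, smul_inv_smul₀ (pA_ne hp), cn_tl, toP_rep]

/-- the intersection -/
def pQ (m : ℕ) : Set (CP (m + 1)) := univ ∩ pA m ∩ (univ ∩ pB m)

lemma pQ_closed : IsClosed (pQ m) := by
  rw [pQ, univ_inter, univ_inter]; exact pA_closed.inter pB_closed

lemma pQ_A {p : CP (m + 1)} (hp : p ∈ pQ m) : p ∈ pA m := hp.1.2

lemma toP_pQ {w : VV m} : toP (cn 1 w) ∈ pQ m ↔ 1 ≤ ‖w‖ ∧ ‖w‖ ≤ 2 := by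
  rw [pQ, univ_inter, univ_inter, mem_inter_iff, toP_pA (cn_ne_left one_ne_zero _),
    toP_pB (cn_ne_left one_ne_zero _)]
  simp [and_comm]

lemma aff_norm {p : CP (m + 1)} (hp : p ∈ pQ m) : 1 ≤ ‖aff p‖ ∧ ‖aff p‖ ≤ 2 := by
  rw [← toP_cn_aff (pQ_A hp)] at hp
  exact toP_pQ.1 hp

lemma aff_ne {p : CP (m + 1)} (hp : p ∈ pQ m) : aff p ≠ 0 := by
  have := (aff_norm hp).1
  intro h
  rw [h, norm_zero] at this
  linarith

lemma g_contOn {A : Set (VV m)} : ContinuousOn (fun w : VV m => toP (cn 1 w)) A :=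
  toP_contOn ((cn_cont.comp (f := fun w : VV m => ((1:ℂ), w)) (by fun_prop)).continuousOn)
    fun _ _ => cn_ne_left one_ne_zero _

/-- the deformation of `pQ` -/
noncomputable def Fq (t : ℝ) (p : CP (m + 1)) : CP (m + 1) :=
  toP (cn 1 ((1 - t) • nz (aff p) + t • aff p))

lemma Fq_mem : ∀ t ∈ Icc (0:ℝ) 1, ∀ p ∈ pQ m, Fq t p ∈ pQ m := by
  intro t ht p hp
  rw [Fq, toP_pQ]
  obtain ⟨h1, h2⟩ := aff_norm hp
  have h0 : 0 < ‖aff p‖ := by linarith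
  have e : (1 - t) • nz (aff p) + t • aff p = ((1 - t) * ‖aff p‖⁻¹ + t) • aff p := by
    rw [nz, smul_smul, ← add_smul]
  have h3 : 0 ≤ (1 - t) * ‖aff p‖⁻¹ + t := by
    have := ht.1; have := ht.2
    have : 0 ≤ 1 - t := by linarith
    positivity
  rw [e, norm_smul, Real.norm_of_nonneg h3, add_mul, mul_assoc, inv_mul_cancel₀ h0.ne', mul_one]
  obtain ⟨ht0, ht1⟩ := ht
  constructor <;> nlinarith

lemma Fq_cont : ContinuousOn (fun x : ℝ × CP (m + 1) => Fq x.1 x.2) (Icc (0:ℝ) 1 ×ˢ pQ m) := by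
  have h1 : ContinuousOn (fun x : ℝ × CP (m + 1) => aff x.2) (Icc (0:ℝ) 1 ×ˢ pQ m) :=
    aff_contOn.comp continuousOn_snd fun x hx => pQ_A hx.2
  have h2 := nz_contOn h1 fun x hx => aff_ne hx.2
  refine toP_contOn ?_ fun _ _ => cn_ne_left one_ne_zero _
  refine cn_cont.comp_continuousOn (f := fun x : ℝ × CP (m + 1) =>
    ((1:ℂ), (1 - x.1) • nz (aff x.2) + x.1 • aff x.2)) ?_
  fun_prop

lemma pQ_data : ContinuousOn (fun p : CP (m + 1) => nz (aff p)) (pQ m) ∧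
    MapsTo (fun p : CP (m + 1) => nz (aff p)) (pQ m) (Metric.sphere 0 1) ∧
    MapsTo (fun w : VV m => toP (cn 1 w)) (Metric.sphere 0 1) (pQ m) ∧
    (∀ p ∈ pQ m, Fq 1 p = p) ∧ (∀ p ∈ pQ m, Fq 0 p = toP (cn 1 (nz (aff p)))) ∧
    ∀ p ∈ pQ m, ∃ s ∈ Metric.sphere (0 : VV m) 1, JoinedIn (pQ m) p (toP (cn 1 s)) := by
  refine ⟨nz_contOn (aff_contOn.mono fun _ h => pQ_A h) fun p hp => aff_ne hp,
    fun p hp => nz_mem (aff_ne hp), fun w hw => ?_, fun p hp => ?_, fun p hp => ?_, fun p hp => ?_⟩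
  · have : ‖w‖ = 1 := by simpa using hw
    rw [toP_pQ, this]; norm_num
  · simp [Fq, toP_cn_aff (pQ_A hp)]
  · simp [Fq]
  · refine ⟨_, nz_mem (aff_ne hp), JoinedIn.symm ?_⟩
    refine JoinedIn.ofLine (f := fun t : ℝ => Fq t p) ?_ (by simp [Fq])
      (by simp [Fq, toP_cn_aff (pQ_A hp)]) ?_
    · exact Fq_cont.comp (f := fun t : ℝ => (t, p)) (by fun_prop) fun t ht => ⟨ht, hp⟩
    · rintro _ ⟨t, ht, rfl⟩
      exact Fq_mem t ht p hp

lemma pQ_ne : (pQ m).Nonempty := by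
  obtain ⟨w, hw⟩ := exists_norm_eq (VV m) zero_le_one
  exact ⟨toP (cn 1 w), toP_pQ.2 (by rw [hw]; norm_num)⟩

/-- The second cohomology of `CP m` has rank at most one, relative version. -/
theorem CP_RO : RO 2 (univ : Set (CP m)) univ := by
  induction m with
  | zero =>
    rw [(subsingleton_univ (α := CP 0)).eq_singleton_of_mem (mem_univ (toP 0))]
    exact (RT.point _).ro
  | succ m ih =>
    rcases Nat.eq_zero_or_pos m with rfl | hm
    · refine RO.mv2 pA_closed pB_closed (fun p _ => p_cover p) pQ_ne RT_pA (RT_pB ?_) ?_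
      · rw [(subsingleton_univ (α := CP 0)).eq_singleton_of_mem (mem_univ (toP 0))]
        exact RT.point _
      · exact RO.deform (circle_RO (VV 0) (by rw [finrank_VV])) pQ_closed.isCompact
          pQ_data.1 g_contOn pQ_data.2.1 pQ_data.2.2.1 Fq Fq_cont Fq_mem pQ_data.2.2.2.1
          pQ_data.2.2.2.2.1 pQ_data.2.2.2.2.2
    · refine RO.mv1 pA_closed pB_closed (fun p _ => p_cover p) pQ_ne RT_pA (RO_pB ih) ?_
      exact RT.deform (sphere_RT 1 (VV m) (by rw [finrank_VV]; omega)) pQ_closed.isCompact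
          pQ_data.1 g_contOn pQ_data.2.1 pQ_data.2.2.1 Fq Fq_cont Fq_mem pQ_data.2.2.2.1
          pQ_data.2.2.2.2.1 pQ_data.2.2.2.2.2

end
end MPS

namespace MPS
set_option linter.unusedSectionVars false
open Set Topology Filter

/-! ### Cup products -/

/-- cup product of cochains on lists -/
def cup {X : Type} (p : ℕ) (f g : List X → ZMod 2) (l : List X) : ZMod 2 :=
  f (l.take (p + 1)) * g (l.drop p)

lemma cup_leibniz {X : Type} (p : ℕ) (f g : List X → ZMod 2) (l : List X)
    (hl : p + 2 ≤ l.length) :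
    dl (cup p f g) l = cup (p + 1) (dl f) g l + cup p f (dl g) l := by
  induction p generalizing f l with
  | zero =>
    match l, hl with
    | x :: y :: l, _ =>
      have e : (fun m => cup 0 f g (x :: m)) = fun m => f [x] * g (x :: m) := by
        funext m; simp [cup]
      rw [dl_cons, e, dl_smul]
      simp only [cup, dl_cons, List.take, List.drop, dl_nil]
      ring_nf
      have h2 : (2 : ZMod 2) = 0 := rfl
      simp only [h2, mul_zero, add_zero]
  | succ p ih =>
    match l, hl with
    | x :: l, hl =>
      have e : (fun m => cup (p + 1) f g (x :: m)) = cup p (fun m => f (x :: m)) g := by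
        funext m; simp [cup]
      rw [dl_cons, e, ih _ _ (by simpa using hl)]
      simp only [cup, List.take_succ_cons, List.drop_succ_cons, dl_cons]
      ring

/-! ### Free involutions -/

/-- powers of the characteristic class -/
def FF {X : Type} (a : X → ZMod 2) : List X → ZMod 2
  | [] => 0
  | [_] => 1
  | x :: y :: l => (a x + a y) * FF a (y :: l)

/-- the primitive -/
def GG {X : Type} (a : X → ZMod 2) : List X → ZMod 2
  | [] => 0
  | x :: l => a x * FF a (x :: l)

section
variable {X : Type} (a : X → ZMod 2)

lemma dl_FF (l : List X) : dl (FF a) l = 0 := by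
  induction l with
  | nil => rfl
  | cons x l ih =>
    match l, ih with
    | [], _ => simp [dl_cons, dl_nil, FF]
    | y :: l, ih =>
      have e : (fun m => FF a (x :: y :: m)) = fun m => (a x + a y) * FF a (y :: m) := rfl
      rw [dl_cons, dl_cons, e, dl_smul]
      rw [dl_cons] at ih
      have ih' : dl (fun m => FF a (y :: m)) l = FF a l := by
        have := congrArg (FF a l + ·) ih
        simpa [← add_assoc, z2] using this
      rw [ih']
      match l with
      | [] => simp only [FF, mul_zero, add_zero]; exact z2 1
      | z :: l =>
        simp only [FF]
        generalize FF a (z :: l) = u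
        generalize a x = p
        generalize a y = q
        generalize a z = r
        revert u p q r; decide

lemma dl_GG (l : List X) (hl : 2 ≤ l.length) : dl (GG a) l = FF a l := by
  match l, hl with
  | x :: y :: l, _ =>
    have e : (fun m => GG a (x :: m)) = fun m => a x * FF a (x :: m) := rfl
    have h := dl_FF a (x :: y :: l)
    rw [dl_cons] at h
    have h' : dl (fun m => FF a (x :: m)) (y :: l) = FF a (y :: l) := by
      have := congrArg (FF a (y :: l) + ·) h
      simpa [← add_assoc, z2] using this
    rw [dl_cons, e, dl_smul, h', GG, FF]
    ring

lemma FF_cup (p : ℕ) (l : List X) (hl : p + 1 ≤ l.length) : cup p (FF a) (FF a) l = FF a l := by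
  induction p generalizing l with
  | zero =>
    match l, hl with
    | x :: l, _ => simp [cup, FF]
  | succ p ih =>
    match l, hl with
    | x :: y :: l, hl =>
      have := ih (y :: l) (by simpa using hl)
      simp only [cup, List.take_succ_cons, List.drop_succ_cons, FF] at this ⊢
      rw [mul_assoc, this]

variable {τ : X → X}

lemma FF_inv (hτ : ∀ x, a (τ x) = a x + 1) (l : List X) : FF a (l.map τ) = FF a l := by
  induction l with
  | nil => rfl
  | cons x l ih =>
    match l, ih with
    | [], _ => rfl
    | y :: l, ih =>
      simp only [List.map_cons, FF] at ih ⊢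
      rw [ih, hτ, hτ]
      congr 1
      generalize a x = p
      generalize a y = q
      revert p q; decide

lemma GG_inv (hτ : ∀ x, a (τ x) = a x + 1) (l : List X) : GG a (l.map τ) = GG a l + FF a l := by
  match l with
  | [] => simp [GG, FF]
  | x :: l =>
    have := FF_inv a hτ (x :: l)
    simp only [List.map_cons, GG] at this ⊢
    rw [this, hτ]; ring

end

/-- invariant cochains -/
def Inv {X : Type} (τ : X → X) (ψ : List X → ZMod 2) : Prop := ∀ l, ψ (l.map τ) = ψ l

/-- `FF a` is the coboundary of an invariant cochain on `O` -/
def Tr {X : Type} [TopologicalSpace X] (τ : X → X) (a : X → ZMod 2) (p : ℕ) (O : Set X) : Prop :=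
  ∃ ψ, Inv τ ψ ∧ LocOn O (fun l => l.length = p + 1 → FF a l = dl ψ l)

section
variable {X : Type} [TopologicalSpace X] {a : X → ZMod 2} {τ : X → X}

lemma Inv.dl {ψ : List X → ZMod 2} (h : Inv τ ψ) : Inv τ (dl ψ) := by
  intro l
  rw [← dl_map]
  congr 1
  funext m
  exact h m

lemma Inv.cup {f g : List X → ZMod 2} (hf : Inv τ f) (hg : Inv τ g) (p : ℕ) :
    Inv τ (cup p f g) := by
  intro l
  simp only [MPS.cup, ← List.map_take, ← List.map_drop, hf _, hg _]

lemma Inv.add {f g : List X → ZMod 2} (hf : Inv τ f) (hg : Inv τ g) : Inv τ (f + g) := by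
  intro l
  simp only [Pi.add_apply, hf l, hg l]

lemma symmetrize (hτ : ∀ x, a (τ x) = a x + 1) (hττ : ∀ x, τ (τ x) = x) {O : Set X} {k : ℕ}
    {ψ : List X → ZMod 2} (h : LocOn O (fun l => l.length = k → ψ (l.map τ) = ψ l)) :
    ∃ ψ', Inv τ ψ' ∧ LocOn O (fun l => l.length = k → ψ' l = ψ l) := by
  classical
  have h2 : ∀ l : List X, (l.map τ).map τ = l := by
    intro l; rw [List.map_map]; convert List.map_id l; exact funext hττ
  refine ⟨fun l => if ∃ x m, l = x :: m ∧ a x = 0 then ψ l else ψ (l.map τ), ?_, ?_⟩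
  · intro l
    match l with
    | [] => simp
    | x :: l =>
      by_cases hx : a x = 0
      · have h1 : ¬ ∃ y m, (x :: l).map τ = y :: m ∧ a y = 0 := by
          rintro ⟨y, m, e, h⟩
          simp only [List.map_cons, List.cons.injEq] at e
          rw [← e.1, hτ, hx] at h
          exact absurd h (by decide)
        have h3 : ∃ y m, (x :: l) = y :: m ∧ a y = 0 := ⟨x, l, rfl, hx⟩
        simp only [if_pos h3, if_neg h1, h2]
      · have h1 : ∃ y m, (x :: l).map τ = y :: m ∧ a y = 0 := by
          refine ⟨τ x, l.map τ, rfl, ?_⟩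
          rw [hτ]; revert hx; generalize a x = p; revert p; decide
        have h3 : ¬ ∃ y m, (x :: l) = y :: m ∧ a y = 0 := by
          rintro ⟨y, m, e, h⟩
          simp only [List.cons.injEq] at e
          exact hx (e.1 ▸ h)
        simp only [if_pos h1, if_neg h3]
  · refine h.mono fun l _ e hl => ?_
    dsimp only
    split_ifs
    · rfl
    · exact e hl

lemma LocOn.union {O U : Set X} (hO : IsOpen O) (hU : IsOpen U) {P : List X → Prop}
    (h : LocOn O P) (h' : LocOn U P) : LocOn (O ∪ U) P := by
  rintro x (hx | hx)
  · obtain ⟨N, hN, h⟩ := h x hx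
    exact ⟨N, mem_nhdsWithin_of_mem_nhds (by rwa [hO.nhdsWithin_eq hx] at hN), h⟩
  · obtain ⟨N, hN, h⟩ := h' x hx
    exact ⟨N, mem_nhdsWithin_of_mem_nhds (by rwa [hU.nhdsWithin_eq hx] at hN), h⟩

lemma LocOn.sub {O : Set X} {P Q : List X → Prop} (h : LocOn O P)
    (e : ∀ l, (∀ m, m ⊆ l → P m) → Q l) : LocOn O Q := by
  intro x hx
  obtain ⟨N, hN, h⟩ := h x hx
  exact ⟨N, hN, fun l hl => e l fun m hm => h m fun y hy => hl y (hm hy)⟩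

lemma Tr.union (hτ : ∀ x, a (τ x) = a x + 1) {O U : Set X}
    (hO : IsOpen O) (hU : IsOpen U) {q : ℕ} (h : Tr τ a (q + 1) O) (h' : Tr τ a 2 U) :
    Tr τ a (q + 3) (O ∪ U) := by
  obtain ⟨η, hη, h⟩ := h
  obtain ⟨ψ, hψ, h'⟩ := h'
  have hF : Inv τ (FF a) := FF_inv a hτ
  refine ⟨cup (q + 1) (FF a) ψ + cup q η (FF a) + cup q η (dl ψ),
    ((hF.cup hψ _).add (hη.cup hF _)).add (hη.cup hψ.dl _), ?_⟩
  have key : ∀ l : List X, l.length = q + 4 →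
      (FF a (l.take (q + 2)) + dl η (l.take (q + 2))) *
        (FF a (l.drop (q + 1)) + dl ψ (l.drop (q + 1))) = 0 →
      FF a l = dl (cup (q + 1) (FF a) ψ + cup q η (FF a) + cup q η (dl ψ)) l := by
    intro l hl h0
    have e1 := cup_leibniz (q + 1) (FF a) ψ l (by omega)
    have e2 := cup_leibniz q η (FF a) l (by omega)
    have e3 := cup_leibniz q η (dl ψ) l (by omega)
    have e4 := FF_cup a (q + 1) l (by omega)
    rw [dl_add, dl_add, e1, e2, e3]
    simp only [cup, dl_FF, dl_dl, mul_zero, zero_mul, add_zero, zero_add] at e4 ⊢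
    rw [← e4]
    revert h0
    generalize FF a (l.take (q + 2)) = u1
    generalize dl η (l.take (q + 2)) = u2
    generalize FF a (l.drop (q + 1)) = u3
    generalize dl ψ (l.drop (q + 1)) = u4
    revert u1 u2 u3 u4
    decide
  refine LocOn.union hO hU ?_ ?_
  · refine h.sub fun l hP hl => key l (by omega) ?_
    rw [hP _ (List.take_subset _ _) (by simp; omega), z2, zero_mul]
  · refine h'.sub fun l hP hl => key l (by omega) ?_
    rw [hP _ (List.drop_subset _ _) (by simp; omega), z2, mul_zero]

lemma Tr.desc (hτ : ∀ x, a (τ x) = a x + 1)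
    (hc : Continuous τ) {n : ℕ} (H : ∀ φ : List X → ZMod 2, Coc n univ φ → Cob n univ φ)
    (h : Tr τ a (n + 1) univ) : ∃ φ : List X → ZMod 2,
      LocOn univ (fun l => l.length = n + 1 → FF a l = dl (φ + fun l => φ (l.map τ)) l) := by
  obtain ⟨ψ, hψ, h⟩ := h
  have h1 : Coc n univ (GG a + ψ) := by
    refine LocOn.mono h fun l _ e hl => ?_
    rw [dl_add, dl_GG a l (by omega), ← e hl, z2]
  obtain ⟨φ, h2⟩ := H _ h1
  refine ⟨φ, (h2.and (h2.pull (f := τ) (A := univ) hc.continuousOn (mapsTo_univ _ _))).mono ?_⟩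
  rintro l - ⟨e1, e2⟩ hl
  have e2' := e2 (by simpa using hl)
  rw [dl_add, dl_map, ← e1 hl, ← e2']
  simp only [Pi.add_apply]
  rw [GG_inv a hτ, hψ l]
  generalize GG a l = u1
  generalize FF a l = u2
  generalize ψ l = u3
  revert u1 u2 u3; decide

lemma no_Tr [Nonempty X] (hτ : ∀ x, a (τ x) = a x + 1) (hττ : ∀ x, τ (τ x) = x)
    (hc : Continuous τ) {N : ℕ} (H : ∀ k ≤ N, ∀ φ : List X → ZMod 2, Coc k univ φ → Cob k univ φ) :
    ∀ n ≤ N, ¬ Tr τ a (n + 1) univ := by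
  intro n
  induction n with
  | zero =>
    intro hn h
    obtain ⟨φ, h⟩ := h.desc hτ hc (H 0 hn)
    obtain ⟨x⟩ := ‹Nonempty X›
    obtain ⟨U, hU, h⟩ := h x (mem_univ x)
    have := h [x] (by simpa using mem_of_mem_nhdsWithin (mem_univ x) hU) rfl
    simp [FF, dl_cons, dl_nil, z2] at this
  | succ n ih =>
    intro hn h
    obtain ⟨φ, h⟩ := h.desc hτ hc (H _ hn)
    refine ih (by omega) ⟨_, fun l => ?_, h⟩
    have h2 : (l.map τ).map τ = l := by
      rw [List.map_map]; convert List.map_id l; exact funext hττ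
    simp only [Pi.add_apply, h2, add_comm]

end
end MPS

namespace MPS
set_option linter.unusedSectionVars false
open Set Topology Filter ComplexConjugate

/-! ### The characteristic class of projective space -/

/-- sign of the real part -/
noncomputable def kap (z : ℂ) : ZMod 2 := if 0 < z.re then 0 else 1

/-- close to the real line -/
def good (z : ℂ) : Prop := z.re ≠ 0 ∧ |z.im| ≤ |z.re| / 8

lemma good_of_sq {w H : ℂ} {M : ℝ} (hM : 0 < M) (h : w ^ 2 = M * H) (h1 : 0 < H.re)
    (h2 : |H.im| ≤ H.re / 4) : good w := by
  have e1 : w.re * w.re - w.im * w.im = M * H.re := by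
    have := congrArg Complex.re h; simpa [sq] using this
  have e2 : w.re * w.im + w.im * w.re = M * H.im := by
    have := congrArg Complex.im h; simpa [sq] using this
  have h3 : 0 < M * H.re := mul_pos hM h1
  have hre : w.re ≠ 0 := by
    intro h0; rw [h0] at e1; nlinarith [mul_self_nonneg w.im]
  refine ⟨hre, ?_⟩
  have h4 : |w.re| * |w.im| * 2 ≤ M * H.re / 4 := by
    have : |w.re * w.im + w.im * w.re| ≤ M * H.re / 4 := by
      rw [e2, abs_mul, abs_of_pos hM, mul_div_assoc]
      exact mul_le_mul_of_nonneg_left h2 hM.le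
    rw [mul_comm w.im, ← mul_two, abs_mul, abs_mul] at this
    simpa using this
  have hpos : 0 < |w.re| := abs_pos.2 hre
  have h5 : |w.re| * |w.re| = w.re * w.re := abs_mul_abs_self _
  by_contra hcon
  push Not at hcon
  nlinarith [mul_self_nonneg w.im, mul_pos hpos (sub_pos.2 hcon)]

lemma kap_mul {w1 w2 w3 : ℂ} (h1 : good w1) (h2 : good w2) (h3 : good w3) :
    kap (w1 * w2 * conj w3) = kap w1 + kap w2 + kap w3 := by
  have aux : ∀ w : ℂ, good w → ∃ t : ℝ, w.im = w.re * t ∧ |t| ≤ 1/8 := by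
    rintro w ⟨h, h'⟩
    refine ⟨w.im / w.re, by field_simp, ?_⟩
    rw [abs_div, div_le_iff₀ (abs_pos.2 h)]
    linarith
  obtain ⟨t1, e1, b1⟩ := aux w1 h1
  obtain ⟨t2, e2, b2⟩ := aux w2 h2
  obtain ⟨t3, e3, b3⟩ := aux w3 h3
  have hre : (w1 * w2 * conj w3).re = (w1.re * w2.re * w3.re) * (1 - t1*t2 + t1*t3 + t2*t3) := by
    simp only [Complex.mul_re, Complex.mul_im, Complex.conj_re, Complex.conj_im, e1, e2, e3]
    ring
  have hpos : 0 < 1 - t1*t2 + t1*t3 + t2*t3 := by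
    have hb : ∀ s t : ℝ, |s| ≤ 1/8 → |t| ≤ 1/8 → |s * t| ≤ 1/64 := by
      intro s t hs ht
      rw [abs_mul]
      nlinarith [abs_nonneg s, abs_nonneg t]
    have := abs_le.1 (hb t1 t2 b1 b2)
    have := abs_le.1 (hb t1 t3 b1 b3)
    have := abs_le.1 (hb t2 t3 b2 b3)
    linarith
  have hk : kap (w1 * w2 * conj w3) = if 0 < w1.re * w2.re * w3.re then 0 else 1 := by
    rw [kap, hre]
    simp only [mul_pos_iff_of_pos_right hpos]
  rw [hk]
  simp only [kap]
  have z : (1 : ZMod 2) + 1 = 0 := rfl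
  rcases lt_or_gt_of_ne h1.1 with s1 | s1 <;> rcases lt_or_gt_of_ne h2.1 with s2 | s2 <;>
    rcases lt_or_gt_of_ne h3.1 with s3 | s3
  · rw [if_neg (mul_neg_of_pos_of_neg (mul_pos_of_neg_of_neg s1 s2) s3).not_gt, if_neg s1.not_gt,
      if_neg s2.not_gt, if_neg s3.not_gt]; rfl
  · rw [if_pos (mul_pos (mul_pos_of_neg_of_neg s1 s2) s3), if_neg s1.not_gt,
      if_neg s2.not_gt, if_pos s3]; rfl
  · rw [if_pos (mul_pos_of_neg_of_neg (mul_neg_of_neg_of_pos s1 s2) s3), if_neg s1.not_gt,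
      if_pos s2, if_neg s3.not_gt]; rfl
  · rw [if_neg (mul_neg_of_neg_of_pos (mul_neg_of_neg_of_pos s1 s2) s3).not_gt, if_neg s1.not_gt,
      if_pos s2, if_pos s3]; rfl
  · rw [if_pos (mul_pos_of_neg_of_neg (mul_neg_of_pos_of_neg s1 s2) s3), if_pos s1,
      if_neg s2.not_gt, if_neg s3.not_gt]; rfl
  · rw [if_neg (mul_neg_of_neg_of_pos (mul_neg_of_pos_of_neg s1 s2) s3).not_gt, if_pos s1,
      if_neg s2.not_gt, if_pos s3]; rfl
  · rw [if_neg (mul_neg_of_pos_of_neg (mul_pos s1 s2) s3).not_gt, if_pos s1,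
      if_pos s2, if_neg s3.not_gt]; rfl
  · rw [if_pos (mul_pos (mul_pos s1 s2) s3), if_pos s1, if_pos s2, if_pos s3]; rfl

lemma kap_pos {r : ℝ} (hr : 0 < r) (w : ℂ) : kap (r * w) = kap w := by
  simp only [kap, Complex.re_ofReal_mul, mul_pos_iff_of_pos_left hr]

lemma kap_neg {w : ℂ} (h : good w) : kap (-w) = kap w + 1 := by
  simp only [kap, Complex.neg_re]
  rcases lt_or_gt_of_ne h.1 with s | s
  · rw [if_pos (by linarith), if_neg (by linarith)]; rfl
  · rw [if_neg (by linarith), if_pos (by linarith)]; rfl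

section
variable {m : ℕ}

/-- hermitian form -/
noncomputable def hm (v w : VV m) : ℂ := ∑ i, conj (v i) * w i

lemma hm_smul (a b : ℂ) (v w : VV m) : hm (a • v) (b • w) = conj a * b * hm v w := by
  simp only [hm, Finset.mul_sum, Pi.smul_apply, smul_eq_mul, map_mul]
  exact Finset.sum_congr rfl fun i _ => by ring

lemma hm_self {v : VV m} (hv : v ≠ 0) : 0 < (hm v v).re ∧ (hm v v).im = 0 := by
  have e : hm v v = ((∑ i, Complex.normSq (v i) : ℝ) : ℂ) := by
    simp only [hm, Complex.ofReal_sum, Complex.normSq_eq_conj_mul_self]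
  rw [e, Complex.ofReal_re, Complex.ofReal_im]
  refine ⟨?_, rfl⟩
  obtain ⟨i, hi⟩ := Function.ne_iff.1 hv
  exact Finset.sum_pos' (fun i _ => Complex.normSq_nonneg _)
    ⟨i, Finset.mem_univ i, Complex.normSq_pos.2 hi⟩

lemma hm_cont : Continuous (fun x : VV m × VV m => hm x.1 x.2) := by
  unfold hm
  refine continuous_finsetSum _ fun i _ => ?_
  exact (Complex.continuous_conj.comp ((continuous_apply i).comp continuous_fst)).mul
    ((continuous_apply i).comp continuous_snd)

/-- near the diagonal -/
def near (v w : VV m) : Prop := 0 < (hm v w).re ∧ |(hm v w).im| ≤ (hm v w).re / 4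

lemma near_nhds {v : VV m} (hv : v ≠ 0) : ∃ U ∈ 𝓝 v, ∀ x ∈ U, ∀ y ∈ U, near x y := by
  have h1 : ∀ᶠ x : VV m × VV m in 𝓝 v ×ˢ 𝓝 v, near x.1 x.2 := by
    rw [← nhds_prod_eq]
    have hre := Complex.continuous_re.comp (hm_cont (m := m))
    have him := Complex.continuous_im.comp (hm_cont (m := m))
    have a1 : ∀ᶠ x : VV m × VV m in 𝓝 (v, v), 0 < (hm x.1 x.2).re :=
      hre.continuousAt.eventually (lt_mem_nhds (hm_self hv).1)
    have a2 : ∀ᶠ x : VV m × VV m in 𝓝 (v, v), |(hm x.1 x.2).im| - (hm x.1 x.2).re / 4 < 0 := by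
      refine ((him.abs.sub (hre.div_const 4)).continuousAt).eventually (gt_mem_nhds ?_)
      show |(hm v v).im| - (hm v v).re / 4 < 0
      have := hm_self hv
      rw [this.2, abs_zero]
      linarith [this.1]
    filter_upwards [a1, a2] with x h1 h2
    exact ⟨h1, by linarith⟩
  obtain ⟨U, hU, h⟩ := Filter.mem_prod_self_iff.1 h1
  exact ⟨U, hU, fun x hx y hy => h (mk_mem_prod hx hy)⟩

/-- a chosen square root -/
noncomputable def rt (z : ℂ) : ℂ :=
  Classical.choose (IsAlgClosed.exists_pow_nat_eq z zero_lt_two)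

lemma rt_sq (z : ℂ) : rt z ^ 2 = z :=
  Classical.choose_spec (IsAlgClosed.exists_pow_nat_eq z zero_lt_two)

open Classical in
/-- scaling factor of the representative -/
noncomputable def mu (z : VV m) : ℂ :=
  if h : z ≠ 0 then Classical.choose (rep_toP h) else 1

lemma mu_ne (z : VV m) : mu z ≠ 0 := by
  unfold mu
  split_ifs with h
  · exact (Classical.choose_spec (rep_toP h)).1
  · exact one_ne_zero

lemma mu_spec {z : VV m} (h : z ≠ 0) : (toP z).rep = mu z • z := by
  unfold mu
  rw [dif_pos h]
  exact (Classical.choose_spec (rep_toP h)).2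

/-- square root of the scaling factor -/
noncomputable def nu (z : VV m) : ℂ := rt (mu z)

lemma nu_sq (z : VV m) : nu z ^ 2 = mu z := rt_sq _

lemma nu_ne (z : VV m) : nu z ≠ 0 := by
  intro h
  have := nu_sq z
  rw [h] at this
  exact mu_ne z (by rw [← this]; simp)

/-- square root of the hermitian product of representatives -/
noncomputable def rho (p q : CP m) : ℂ := rt (hm p.rep q.rep)

/-- the basic two-cocycle -/
noncomputable def cc : List (CP m) → ZMod 2
  | [p, q, r] => kap (rho p q * rho q r * conj (rho p r))
  | _ => 0

/-- the normalized square root -/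
noncomputable def ww (z z' : VV m) : ℂ := rho (toP z) (toP z') * nu z * conj (nu z')

/-- the one-cochain -/
noncomputable def nn : List (VV m) → ZMod 2
  | [z, z'] => kap (ww z z')
  | _ => 0

lemma ww_good {z z' : VV m} (hz : z ≠ 0) (hz' : z' ≠ 0) (h : near z z') : good (ww z z') := by
  refine good_of_sq (M := Complex.normSq (mu z) * Complex.normSq (mu z')) (H := hm z z')
    (mul_pos (Complex.normSq_pos.2 (mu_ne z)) (Complex.normSq_pos.2 (mu_ne z'))) ?_ h.1 h.2
  have e : (rho (toP z) (toP z')) ^ 2 = conj (mu z) * mu z' * hm z z' := by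
    rw [rho, rt_sq, mu_spec hz, mu_spec hz', hm_smul]
  rw [ww, mul_pow, mul_pow, e, nu_sq, ← map_pow, nu_sq]
  push_cast
  rw [Complex.normSq_eq_conj_mul_self, Complex.normSq_eq_conj_mul_self]
  ring

lemma cc_eq {x y z : VV m} (hx : x ≠ 0) (hy : y ≠ 0) (hz : z ≠ 0)
    (h1 : near x y) (h2 : near y z) (h3 : near x z) :
    cc [toP x, toP y, toP z] = kap (ww y z) + kap (ww x z) + kap (ww x y) := by
  have h := kap_mul (ww_good hx hy h1) (ww_good hy hz h2) (ww_good hx hz h3)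
  have e : ww x y * ww y z * conj (ww x z) =
      ((Complex.normSq (nu x) * Complex.normSq (nu y) * Complex.normSq (nu z) : ℝ) : ℂ) *
      (rho (toP x) (toP y) * rho (toP y) (toP z) * conj (rho (toP x) (toP z))) := by
    push_cast
    simp only [Complex.normSq_eq_conj_mul_self, ww, map_mul, Complex.conj_conj]
    ring
  rw [e, kap_pos (mul_pos (mul_pos (Complex.normSq_pos.2 (nu_ne x)) (Complex.normSq_pos.2 (nu_ne y)))
    (Complex.normSq_pos.2 (nu_ne z)))] at h
  rw [cc, h]
  ring

lemma near_loc {W : Type} [TopologicalSpace W] {D : Set W} {f : W → VV m}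
    (hf : ContinuousOn f D) (h0 : ∀ x ∈ D, f x ≠ 0) :
    LocOn D (fun l => ∀ x ∈ l, ∀ y ∈ l, near (f x) (f y)) := by
  intro x hx
  obtain ⟨U, hU, h⟩ := near_nhds (h0 x hx)
  exact ⟨f ⁻¹' U, hf x hx hU, fun l hl x hx y hy => h _ (hl x hx) _ (hl y hy)⟩

lemma section_loc {W : Type} [TopologicalSpace W] {D : Set W} {f : W → VV m}
    (hf : ContinuousOn f D) (h0 : ∀ x ∈ D, f x ≠ 0) :
    LocOn D (fun l => l.length = 3 →
      cc (l.map (fun x => toP (f x))) = dl (fun k => nn (k.map f)) l) := by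
  refine (near_loc hf h0).mono ?_
  intro l hl h hk
  match l, hk with
  | [x, y, z], _ =>
    simp only [List.mem_cons, List.not_mem_nil, or_false, forall_eq_or_imp, forall_eq] at h hl
    have := cc_eq (h0 x hl.1) (h0 y hl.2.1) (h0 z hl.2.2) h.1.2.1 h.2.1.2.2 h.1.2.2
    simp only [List.map_cons, List.map_nil, dl_cons, dl_nil, nn, this]
    ring

/-- the standard charts -/
def chart (j : Fin (m + 1)) : Set (CP m) := {p | p.rep j ≠ 0}

lemma chart_toP {v : VV m} (hv : v ≠ 0) (j : Fin (m + 1)) : toP v ∈ chart j ↔ v j ≠ 0 := by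
  obtain ⟨a, ha, e⟩ := rep_toP hv
  simp only [chart, mem_ofPred_eq, e, Pi.smul_apply, smul_eq_mul, ne_eq, mul_eq_zero, ha, false_or]

lemma chart_open (j : Fin (m + 1)) : IsOpen (chart (m := m) j) := by
  apply isOpen_CP
  have : {v : VV m | v ≠ 0 ∧ toP v ∈ chart j} = {v | v ≠ 0} ∩ {v | v j ≠ 0} := by
    ext v
    simp only [mem_inter_iff, mem_ofPred_eq]
    exact and_congr_right fun hv => chart_toP hv j
  rw [this]
  exact isOpen_ne.inter (isOpen_ne_fun (continuous_apply j) continuous_const)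

lemma chart_cover (p : CP m) : ∃ j, p ∈ chart j := by
  obtain ⟨i, hi⟩ := Function.ne_iff.1 p.rep_nonzero
  exact ⟨i, hi⟩

lemma chart_cob (j : Fin (m + 1)) : Cob 2 (chart j) (cc (m := m)) := by
  have hf : ContinuousOn (fun p : CP m => (p.rep j)⁻¹ • p.rep) (chart j) := by
    intro p hp
    refine ContinuousAt.continuousWithinAt
      (contAt_lift (g := fun v : VV m => (v j)⁻¹ • v) ?_ ?_)
    · intro v hv
      obtain ⟨a, ha, e⟩ := rep_toP hv
      show ((toP v).rep j)⁻¹ • (toP v).rep = _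
      rw [e, smul_smul, Pi.smul_apply, smul_eq_mul, mul_inv, mul_assoc, mul_comm, mul_assoc,
        mul_inv_cancel₀ ha, mul_one]
    · have h0 : p.rep j ≠ 0 := hp
      exact ((continuous_apply j).continuousAt.inv₀ h0).smul continuousAt_id
  have h0 : ∀ p ∈ chart (m := m) j, (p.rep j)⁻¹ • p.rep ≠ 0 := fun p hp =>
    smul_ne_zero (inv_ne_zero hp) p.rep_nonzero
  refine ⟨fun k => nn (k.map (fun p : CP m => (p.rep j)⁻¹ • p.rep)), (section_loc hf h0).mono ?_⟩
  intro l hl h hk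
  rw [← h hk]
  congr 1
  symm
  refine list_map_id_on (A := chart j) (fun p hp => ?_) hl
  rw [toP_smul (inv_ne_zero hp), toP_rep]

lemma cc_coc : Coc 2 univ (cc (m := m)) := by
  intro p _
  obtain ⟨j, hj⟩ := chart_cover p
  obtain ⟨U, hU, h⟩ := (chart_cob j).coc p hj
  rw [(chart_open j).nhdsWithin_eq hj] at hU
  exact ⟨U, by rwa [nhdsWithin_univ], h⟩

/-! ### The double cover -/

lemma toP_neg (z : VV m) : toP (-z) = toP z := by
  rw [← neg_one_smul ℂ z, toP_smul (by norm_num)]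

lemma nu_neg {z : VV m} (h : z ≠ 0) :
    nu (-z) = Complex.I * nu z ∨ nu (-z) = - (Complex.I * nu z) := by
  have e : mu (-z) = - mu z := by
    have h1 := mu_spec h
    have h2 := mu_spec (neg_ne_zero.2 h)
    rw [toP_neg, h1] at h2
    obtain ⟨i, hi⟩ := Function.ne_iff.1 h
    have h3 := congrFun h2 i
    simp only [Pi.smul_apply, Pi.neg_apply, smul_eq_mul] at h3
    have h4 : z i ≠ 0 := hi
    apply mul_right_cancel₀ h4
    linear_combination h3
  apply sq_eq_sq_iff_eq_or_eq_neg.1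
  rw [nu_sq, e, mul_pow, nu_sq, Complex.I_sq]; ring

open Classical in
/-- the sheet function -/
noncomputable def aa (z : VV m) : ZMod 2 := if nu (-z) = Complex.I * nu z then 0 else 1

lemma aa_neg {z : VV m} (h : z ≠ 0) : aa (-z) = aa z + 1 := by
  unfold aa
  rw [neg_neg]
  have I2 : Complex.I * Complex.I = -1 := Complex.I_mul_I
  by_cases h1 : nu (-z) = Complex.I * nu z
  · rw [if_pos h1, if_neg, zero_add]
    rw [h1, ← mul_assoc, I2, neg_one_mul]
    exact fun e => nu_ne z (self_eq_neg.1 e)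
  · rw [if_neg h1, if_pos]
    · rfl
    · rw [(nu_neg h).resolve_left h1, mul_neg, ← mul_assoc, I2, neg_one_mul, neg_neg]

lemma kap_ww_neg {z z' : VV m} (hz : z ≠ 0) (hz' : z' ≠ 0) (h : near z z') :
    kap (ww (-z) (-z')) = kap (ww z z') + (aa z + aa z') := by
  have hg := ww_good hz hz' h
  have I2 : Complex.I * Complex.I = -1 := Complex.I_mul_I
  have I1 : Complex.I ≠ 0 := Complex.I_ne_zero
  have key : ∀ {z : VV m}, z ≠ 0 → (nu (-z) = Complex.I * nu z ∧ aa z = 0) ∨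
      (nu (-z) = - (Complex.I * nu z) ∧ aa z = 1) := by
    intro z hz
    by_cases h1 : nu (-z) = Complex.I * nu z
    · exact Or.inl ⟨h1, if_pos h1⟩
    · exact Or.inr ⟨(nu_neg hz).resolve_left h1, if_neg h1⟩
  have e : ww (-z) (-z') = rho (toP z) (toP z') * nu (-z) * conj (nu (-z')) := by
    rw [ww, toP_neg, toP_neg]
  rcases key hz with ⟨n1, a1⟩ | ⟨n1, a1⟩ <;> rcases key hz' with ⟨n2, a2⟩ | ⟨n2, a2⟩ <;>
    rw [a1, a2, e, n1, n2]
  · have : rho (toP z) (toP z') * (Complex.I * nu z) * conj (Complex.I * nu z') = ww z z' := by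
      rw [map_mul, Complex.conj_I, ww]
      linear_combination (-(rho (toP z) (toP z') * nu z * conj (nu z'))) * I2
    rw [this]; simp
  · have : rho (toP z) (toP z') * (Complex.I * nu z) * conj (-(Complex.I * nu z')) = -ww z z' := by
      rw [map_neg, map_mul, Complex.conj_I, ww]
      linear_combination ((rho (toP z) (toP z') * nu z * conj (nu z'))) * I2
    rw [this, kap_neg hg]; simp
  · have : rho (toP z) (toP z') * (-(Complex.I * nu z)) * conj ((Complex.I * nu z')) = -ww z z' := by
      rw [map_mul, Complex.conj_I, ww]
      linear_combination ((rho (toP z) (toP z') * nu z * conj (nu z'))) * I2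
    rw [this, kap_neg hg]; simp
  · have : rho (toP z) (toP z') * (-(Complex.I * nu z)) * conj (-(Complex.I * nu z')) = ww z z' := by
      rw [map_neg, map_mul, Complex.conj_I, ww]
      linear_combination (-(rho (toP z) (toP z') * nu z * conj (nu z'))) * I2
    rw [this]
    have : (1 : ZMod 2) + 1 = 0 := rfl
    rw [this, add_zero]

/-- the sphere -/
abbrev SS (m : ℕ) := {v : VV m // v ∈ Metric.sphere (0 : VV m) 1}

/-- antipode -/
def tau (z : SS m) : SS m := ⟨-z.1, by simp⟩

/-- sheet function on the sphere -/
noncomputable def as (z : SS m) : ZMod 2 := aa z.1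

lemma SS_ne (z : SS m) : z.1 ≠ 0 := sphere_ne z.2

lemma as_tau (z : SS m) : as (tau z) = as z + 1 := aa_neg (SS_ne z)

lemma tau_tau (z : SS m) : tau (tau z) = z := Subtype.ext (neg_neg _)

lemma tau_cont : Continuous (tau (m := m)) := by
  unfold tau
  fun_prop

/-- projection of the sphere -/
noncomputable def pS (z : SS m) : CP m := toP z.1

lemma pS_cont : Continuous (pS (m := m)) := by
  have := toP_contOn (f := fun z : SS m => z.1) (A := univ) continuous_subtype_val.continuousOn
    (fun z _ => SS_ne z)
  exact continuousOn_univ.1 this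

lemma pS_tau (z : SS m) : pS (tau z) = pS z := toP_neg _

lemma Tr_of_cob {O : Set (CP m)} (h : Cob 2 O cc) : Tr tau as 2 (pS (m := m) ⁻¹' O) := by
  obtain ⟨ψ1, h1⟩ := h
  have h1' := LocOn.pull h1 (pS_cont (m := m)).continuousOn (mapsTo_preimage pS O)
  let ψ0 : List (SS m) → ZMod 2 := (fun l => nn (l.map Subtype.val)) + GG as
  have hinv : LocOn (univ : Set (SS m)) (fun l => l.length = 2 → ψ0 (l.map tau) = ψ0 l) := by
    refine (near_loc (f := fun z : SS m => z.1) continuous_subtype_val.continuousOn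
      (fun z _ => SS_ne z)).mono ?_
    intro l _ h hk
    match l, hk with
    | [x, y], _ =>
      simp only [ψ0, Pi.add_apply]
      rw [GG_inv as as_tau]
      have := kap_ww_neg (SS_ne x) (SS_ne y) (h x (by simp) y (by simp))
      simp only [List.map_cons, List.map_nil, nn, FF, tau, this, mul_one, as]
      have := z2 (aa x.1 + aa y.1)
      linear_combination this
  obtain ⟨ψ', hi, h2⟩ := symmetrize as_tau tau_tau hinv
  have h3 : LocOn (univ : Set (SS m)) (fun l => l.length = 3 → dl ψ' l = dl ψ0 l) := by
    refine h2.sub fun l hl hk => ?_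
    exact dl_congr _ _ _ fun k hkl hk' => hl k hkl.subset (by omega)
  have h4 := section_loc (f := fun z : SS m => z.1) (D := univ) continuous_subtype_val.continuousOn
      (fun z _ => SS_ne z)
  have hr : ∀ {P : List (SS m) → Prop}, LocOn univ P → LocOn (pS (m := m) ⁻¹' O) P := by
    intro P hP x _
    obtain ⟨U, hU, h⟩ := hP x (mem_univ x)
    exact ⟨U, mem_nhdsWithin_of_mem_nhds (by rwa [nhdsWithin_univ] at hU), h⟩
  refine ⟨ψ' + fun l => ψ1 (l.map pS), hi.add ?_, ?_⟩
  · intro l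
    show ψ1 _ = ψ1 _
    congr 1
    rw [List.map_map]
    exact List.map_congr_left fun z _ => pS_tau z
  · refine (h1'.and ((hr h3).and (hr h4))).mono ?_
    rintro l _ ⟨e1, e2, e3⟩ hk
    have e1 := e1 (by simpa using hk)
    have e2 := e2 (by simpa using hk)
    have e3 := e3 (by simpa using hk)
    rw [dl_add, e2, dl_map, ← e1, dl_add, ← e3, dl_GG _ _ (by omega)]
    have := z2 (cc (l.map pS))
    show _ = cc (l.map pS) + _ + _
    linear_combination -this

lemma sphere_cob (k : ℕ) (hk : k ≤ 2 * m) (φ : List (SS m) → ZMod 2) (h : Coc k univ φ) :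
    Cob k univ φ := by
  classical
  have hR := sphere_RT k (VV m) (by rw [finrank_VV]; omega)
  obtain ⟨v0, hv0, _⟩ := toP_surj (m := m) (toP (fun _ => 1))
  let g : Unit × VV m → SS m := fun x =>
    if h : x.2 ∈ Metric.sphere (0 : VV m) 1 then ⟨x.2, h⟩ else ⟨v0, hv0⟩
  have hg : ContinuousOn g (({()} : Set Unit) ×ˢ Metric.sphere (0 : VV m) 1) := by
    rw [IsInducing.subtypeVal.continuousOn_iff]
    refine continuous_snd.continuousOn.congr ?_
    intro x hx
    simp only [Function.comp, g, dif_pos hx.2]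
  have h1 := h.pull hg (mapsTo_univ _ _)
  have h2 := hR Unit {()} isCompact_singleton isPreconnected_singleton _ v0 hv0 h1 (by
    rw [singleton_prod_singleton]
    refine Cob.point (h1.restrict ?_)
    rintro x rfl
    exact ⟨rfl, hv0⟩)
  have h3 := h2.pull (A := univ) (f := fun z : SS m => ((), z.1)) (by fun_prop)
    (fun z _ => ⟨rfl, z.2⟩)
  refine h3.congr fun l _ => ?_
  simp only [List.map_map]
  congr 1
  symm
  refine list_map_id_on (A := univ) (fun z _ => ?_) (fun _ _ => mem_univ _)
  simp only [Function.comp, g, dif_pos z.2]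

/-- The genus bound. -/
theorem genus {k : ℕ} (O : ℕ → Set (CP m)) (ho : ∀ i, IsOpen (O i))
    (hc : ∀ i ≤ k, Cob 2 (O i) cc) (hO : ∀ p, ∃ i ≤ k, p ∈ O i) : m ≤ k := by
  by_contra hk
  push Not at hk
  have hT : ∀ j ≤ k, Tr tau as (2 * j + 2) (⋃ i ∈ Iic j, pS (m := m) ⁻¹' O i) := by
    intro j
    induction j with
    | zero =>
      intro _
      have e : (⋃ i ∈ Iic 0, pS (m := m) ⁻¹' O i) = pS ⁻¹' O 0 := by
        ext x; simp
      rw [e]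
      exact Tr_of_cob (hc 0 (Nat.zero_le _))
    | succ j ih =>
      intro hj
      have e : (⋃ i ∈ Iic (j + 1), pS (m := m) ⁻¹' O i) =
          (⋃ i ∈ Iic j, pS (m := m) ⁻¹' O i) ∪ pS ⁻¹' O (j + 1) := by
        ext x
        simp only [mem_iUnion, mem_Iic, mem_union, mem_preimage, exists_prop]
        constructor
        · rintro ⟨i, hi, h⟩
          rcases Nat.lt_or_ge i (j + 1) with h1 | h1
          · exact Or.inl ⟨i, by omega, h⟩
          · obtain rfl : i = j + 1 := by omega
            exact Or.inr h
        · rintro (⟨i, hi, h⟩ | h)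
          · exact ⟨i, by omega, h⟩
          · exact ⟨_, le_rfl, h⟩
      rw [e]
      have := Tr.union (q := 2 * j + 1) as_tau
        (isOpen_biUnion fun i _ => (ho i).preimage pS_cont) ((ho (j + 1)).preimage pS_cont)
        (ih (by omega)) (Tr_of_cob (hc _ hj))
      exact this
  have e : (⋃ i ∈ Iic k, pS (m := m) ⁻¹' O i) = univ := by
    ext x
    simp only [mem_iUnion, mem_Iic, mem_preimage, exists_prop, mem_univ, iff_true]
    exact hO _
  have h := hT k le_rfl
  rw [e] at h
  haveI : Nonempty (SS m) := by
    obtain ⟨v0, hv0, _⟩ := toP_surj (m := m) (toP (fun _ => 1))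
    exact ⟨⟨v0, hv0⟩⟩
  exact no_Tr as_tau tau_tau tau_cont (N := 2 * m) (fun k hk φ => sphere_cob k hk φ)
    (2 * k + 1) (by omega) h

end
end MPS

namespace MPS
set_option linter.unusedSectionVars false
open Set Topology Filter

/-! ### Products of projective spaces -/

/-- the product -/
abbrev XX {r : ℕ} (m : Fin r → ℕ) := (i : Fin r) → CP (m i)

section
variable {r : ℕ} {m : Fin r → ℕ}

/-- the generators -/
noncomputable def xx (m : Fin r → ℕ) (i : Fin r) : List (XX m) → ZMod 2 :=
  fun l => cc (l.map (fun x => x i))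

/-- linear combinations of the generators -/
noncomputable def comb (m : Fin r → ℕ) (a : Fin r → ZMod 2) : List (XX m) → ZMod 2 :=
  ∑ i, a i • xx m i

lemma xx_coc (i : Fin r) : Coc 2 univ (xx m i) :=
  cc_coc.pull (continuous_apply i).continuousOn (mapsTo_univ _ _)

lemma comb_coc (a : Fin r → ZMod 2) : Coc 2 univ (comb m a) :=
  Coc.sum _ _ fun i _ => (xx_coc i).smul _

lemma comb_add (a b : Fin r → ZMod 2) : comb m (a + b) = comb m a + comb m b := by
  simp only [comb, Pi.add_apply, add_smul, Finset.sum_add_distrib]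

lemma comb_single (i : Fin r) : comb m (Pi.single i 1) = xx m i := by
  rw [comb, Finset.sum_eq_single i]
  · simp
  · intro j _ hj; simp [hj]
  · simp

lemma comb_apply (a : Fin r → ZMod 2) (l : List (XX m)) : comb m a l = ∑ i, a i * xx m i l := by
  simp [comb, Finset.sum_apply]

/-- pulling back the basic class by a constant map -/
lemma cob_const {W : Type} [TopologicalSpace W] (A : Set W) {n : ℕ} (q : CP n) :
    Cob 2 A (fun l => cc (l.map (fun _ => q))) :=
  Cob.pull (Cob.point (cc_coc.restrict (subset_univ {q}))) continuousOn_const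
    (fun _ _ => rfl)

/-- base point -/
noncomputable def pt (m : Fin r → ℕ) : XX m := fun _ => toP (fun _ => 1)

/-- axis inclusion -/
noncomputable def ax (m : Fin r → ℕ) (i : Fin r) (p : CP (m i)) : XX m :=
  Function.update (pt m) i p

lemma ax_cont (i : Fin r) : Continuous (ax m i) := continuous_const.update i continuous_id

lemma xx_ax (i : Fin r) (l : List (CP (m i))) : xx m i (l.map (ax m i)) = cc l := by
  rw [xx, List.map_map]
  congr 1
  refine list_map_id_on (A := univ) (fun p _ => ?_) (fun _ _ => mem_univ _)
  simp [ax]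

lemma xx_ax_ne {i j : Fin r} (h : j ≠ i) (A : Set (CP (m i))) :
    Cob 2 A (fun l => xx m j (l.map (ax m i))) := by
  refine (cob_const A (pt m j)).congr fun l _ => ?_
  rw [xx, List.map_map]
  congr 1
  apply List.map_congr_left
  intro p _
  simp [ax, h]

lemma genus_comb {k : ℕ} (a : Fin r → ZMod 2) (O : ℕ → Set (XX m)) (ho : ∀ i, IsOpen (O i))
    (hc : ∀ i ≤ k, Cob 2 (O i) (comb m a)) (hO : ∀ p, ∃ i ≤ k, p ∈ O i) (i : Fin r)
    (hi : a i ≠ 0) : m i ≤ k := by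
  have h1 : a i = 1 := by
    revert hi; generalize a i = b; revert b; decide
  refine genus (fun t => ax m i ⁻¹' O t) (fun t => (ho t).preimage (ax_cont i)) ?_
    (fun p => hO _)
  intro t ht
  have h := (hc t ht).pull (A := ax m i ⁻¹' O t) (ax_cont i).continuousOn (mapsTo_preimage _ _)
  have h2 : Cob 2 (ax m i ⁻¹' O t) (∑ j ∈ Finset.univ.erase i,
      a j • (fun l : List (CP (m i)) => xx m j (l.map (ax m i)))) :=
    Cob.sum _ _ fun j hj => (xx_ax_ne (Finset.ne_of_mem_erase hj) _).smul _
  refine (h.add h2).congr fun l _ => ?_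
  have e := Finset.add_sum_erase Finset.univ (fun j => a j * xx m j (l.map (ax m i)))
    (Finset.mem_univ i)
  simp only [Pi.add_apply, comb_apply, Finset.sum_apply, Pi.smul_apply, smul_eq_mul]
  rw [← e, add_assoc, z2, add_zero, h1, one_mul, xx_ax]

lemma indep (hm : ∀ i, 0 < m i) (a : Fin r → ZMod 2) (h : Cob 2 univ (comb m a)) : a = 0 := by
  funext i
  by_contra hi
  have := genus_comb (k := 0) a (fun _ => univ) (fun _ => isOpen_univ) (fun _ _ => h)
    (fun p => ⟨0, le_rfl, mem_univ p⟩) i hi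
  have := hm i
  omega

/-- projection to the product of the first factors -/
noncomputable def clamp (m : Fin r → ℕ) (j : ℕ) (x : XX m) : XX m :=
  fun i => if i.1 < j then x i else pt m i

lemma clamp_cont (j : ℕ) : Continuous (clamp m j) := by
  apply continuous_pi
  intro i
  unfold clamp
  by_cases h : i.1 < j
  · simp only [if_pos h]; exact continuous_apply i
  · simp only [if_neg h]; exact continuous_const

lemma mem_clamp {j : ℕ} {x : XX m} : x ∈ range (clamp m j) ↔ ∀ i : Fin r, j ≤ i.1 → x i = pt m i := by
  constructor
  · rintro ⟨y, rfl⟩ i hi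
    simp [clamp, not_lt.2 hi]
  · intro h
    refine ⟨x, funext fun i => ?_⟩
    unfold clamp
    split_ifs with hi
    · rfl
    · exact (h i (not_lt.1 hi)).symm

lemma gen (hm : ∀ i, 0 < m i) {φ : List (XX m) → ZMod 2} (hφ : Coc 2 univ φ) :
    ∀ j ≤ r, ∃ a, Cob 2 (range (clamp m j)) (φ + comb m a) := by
  intro j
  induction j with
  | zero =>
    intro _
    refine ⟨0, ?_⟩
    have e : range (clamp m 0) = {pt m} := by
      ext x
      rw [mem_clamp, mem_singleton_iff]
      exact ⟨fun h => funext fun i => h i (Nat.zero_le _), fun h i _ => by rw [h]⟩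
    rw [e]
    exact Cob.point ((hφ.add (comb_coc 0)).restrict (subset_univ _))
  | succ j ih =>
    intro hj
    obtain ⟨a, ha⟩ := ih (by omega)
    let J : Fin r := ⟨j, hj⟩
    let g : XX m × CP (m J) → XX m := fun x => Function.update x.1 J x.2
    have hg : Continuous g := continuous_fst.update J continuous_snd
    let f : XX m → XX m × CP (m J) := fun x => (Function.update x J (pt m J), x J)
    have hf : Continuous f := (continuous_id.update J continuous_const).prodMk (continuous_apply J)
    have hgf : ∀ x, g (f x) = x := by
      intro x; simp [g, f]
    have hmf : MapsTo f (range (clamp m (j + 1))) (range (clamp m j) ×ˢ univ) := by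
      intro x hx
      refine ⟨?_, mem_univ _⟩
      rw [mem_clamp] at hx ⊢
      intro i hi
      by_cases h : i = J
      · subst h; simp [f]
      · have : i.1 ≠ j := fun e => h (Fin.ext e)
        simp only [f, Function.update_of_ne h]
        exact hx i (by omega)
    have hmg : MapsTo g (range (clamp m j) ×ˢ {pt m J}) (range (clamp m j)) := by
      rintro ⟨y, p⟩ ⟨hy, hp⟩
      have hp : p = pt m J := hp
      rw [mem_clamp] at hy ⊢
      intro i hi
      by_cases h : i = J
      · subst h; simp [g, hp]
      · simp only [g, Function.update_of_ne h]
        exact hy i hi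
    have hJ : Cob 2 (range (clamp m j)) (xx m J) := by
      refine (cob_const _ (pt m J)).congr fun l hl => ?_
      rw [xx]
      congr 1
      apply List.map_congr_left
      intro x hx
      exact mem_clamp.1 (hl x hx) J le_rfl
    have hψ := hφ.add (comb_coc a)
    have back : ∀ χ : List (XX m) → ZMod 2,
        Cob 2 (range (clamp m j) ×ˢ univ) (fun l => χ (l.map g)) →
        Cob 2 (range (clamp m (j + 1))) χ := by
      intro χ h
      refine (h.pull hf.continuousOn hmf).congr fun l _ => ?_
      simp only [List.map_map]
      congr 1
      symm
      exact list_map_id_on (A := univ) (fun x _ => hgf x) (fun _ _ => mem_univ _)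
    rcases CP_RO (m := m J) (XX m) (range (clamp m j)) (isCompact_range (clamp_cont j))
      (isPreconnected_range (clamp_cont j)) (fun l => (φ + comb m a) (l.map g))
      (fun l => xx m J (l.map g)) (pt m J) (mem_univ _)
      (hψ.pull hg.continuousOn (mapsTo_univ _ _)) (ha.pull hg.continuousOn hmg)
      ((xx_coc J).pull hg.continuousOn (mapsTo_univ _ _)) (hJ.pull hg.continuousOn hmg) with h | h | h
    · exact ⟨a, back _ h⟩
    · exfalso
      have h := (back (xx m J) h).pull (A := univ) (ax_cont J).continuousOn (by
        intro p _
        rw [mem_clamp]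
        intro i hi
        have : i ≠ J := fun e => by rw [e] at hi; simp [J] at hi
        simp [ax, this])
      have h : Cob 2 univ (cc (m := m J)) := h.congr fun l _ => (xx_ax J l).symm
      have := genus (k := 0) (fun _ => univ) (fun _ => isOpen_univ) (fun _ _ => h)
        (fun p => ⟨0, le_rfl, mem_univ p⟩)
      have := hm J
      omega
    · refine ⟨a + Pi.single J 1, ?_⟩
      rw [comb_add, comb_single, ← add_assoc]
      exact back _ h

lemma gen' (hm : ∀ i, 0 < m i) {φ : List (XX m) → ZMod 2} (hφ : Coc 2 univ φ) :
    ∃ a, Cob 2 univ (φ + comb m a) := by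
  obtain ⟨a, h⟩ := gen hm hφ r le_rfl
  refine ⟨a, h.restrict fun x _ => mem_clamp.2 fun i hi => ?_⟩
  have := i.2
  omega

/-- trivializing cover -/
def cov (m : Fin r → ℕ) (i : Fin r) (t : ℕ) : Set (XX m) :=
  {x | ∃ h : t < m i + 1, x i ∈ chart ⟨t, h⟩}

lemma cov_eq (i : Fin r) {t : ℕ} (h : t < m i + 1) :
    cov m i t = (fun x : XX m => x i) ⁻¹' chart ⟨t, h⟩ := by
  ext x
  simp only [cov, mem_preimage, mem_ofPred_eq]
  exact ⟨fun ⟨_, h⟩ => h, fun h' => ⟨h, h'⟩⟩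

lemma cov_open (i : Fin r) (t : ℕ) : IsOpen (cov m i t) := by
  by_cases h : t < m i + 1
  · rw [cov_eq i h]
    exact (chart_open _).preimage (continuous_apply i)
  · have : cov m i t = ∅ := by
      ext x
      simp only [cov, mem_ofPred_eq, mem_empty_iff_false, iff_false]
      exact fun ⟨h', _⟩ => h h'
    rw [this]; exact isOpen_empty

lemma cov_cob (i : Fin r) (t : ℕ) (ht : t ≤ m i) : Cob 2 (cov m i t) (xx m i) := by
  rw [cov_eq i (Nat.lt_succ_of_le ht)]
  exact (chart_cob _).pull (continuous_apply i).continuousOn (mapsTo_preimage _ _)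

lemma cov_cover (i : Fin r) (x : XX m) : ∃ t ≤ m i, x ∈ cov m i t := by
  obtain ⟨j, hj⟩ := chart_cover (x i)
  exact ⟨j.1, Nat.le_of_lt_succ j.2, j.2, hj⟩

end

lemma card_le {r s : ℕ} {m : Fin r → ℕ} {m' : Fin s → ℕ} (hm : ∀ i, 0 < m i)
    (hm' : ∀ j, 0 < m' j) (h : XX m ≃ₜ XX m') (k : ℕ) :
    Fintype.card {j // m' j ≤ k} ≤ Fintype.card {i // m i ≤ k} := by
  have h1 : ∀ j, Coc 2 univ (fun l : List (XX m) => xx m' j (l.map h)) := fun j =>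
    (xx_coc j).pull h.continuous.continuousOn (mapsTo_univ _ _)
  choose A hA using fun j => gen' hm (h1 j)
  have hs : ∀ j i, A j i ≠ 0 → m i ≤ m' j := by
    intro j i hi
    refine genus_comb (A j) (fun t => h ⁻¹' cov m' j t)
      (fun t => (cov_open j t).preimage h.continuous) ?_ (fun p => cov_cover j _) i hi
    intro t ht
    have h2 := (cov_cob j t ht).pull (A := h ⁻¹' cov m' j t) h.continuous.continuousOn
      (mapsTo_preimage _ _)
    have h3 := (hA j).restrict (subset_univ (h ⁻¹' cov m' j t))
    rw [add_comm] at h3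
    exact h3.cancel h2
  let v : {j // m' j ≤ k} → ({i // m i ≤ k} → ZMod 2) := fun j i => A j.1 i.1
  have hv : LinearIndependent (ZMod 2) v := by
    rw [Fintype.linearIndependent_iff]
    intro c hc
    let c' : Fin s → ZMod 2 := fun j => if hj : m' j ≤ k then c ⟨j, hj⟩ else 0
    have hz : ∀ i, ∑ j, c' j * A j i = 0 := by
      intro i
      have e : ∑ j, c' j * A j i = ∑ j : {j // m' j ≤ k}, c j * A j.1 i := by
        rw [← Finset.sum_filter_of_ne (p := fun j => m' j ≤ k),
          Finset.sum_subtype (p := fun j => m' j ≤ k) _ (by simp)]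
        · refine Finset.sum_congr rfl fun j _ => ?_
          simp only [c', dif_pos j.2]
        · intro j _ hne
          by_contra hj
          simp only [c', dif_neg hj, zero_mul, ne_eq, not_true_eq_false] at hne
      rw [e]
      by_cases hi : m i ≤ k
      · have := congrFun hc ⟨i, hi⟩
        simpa [v, Finset.sum_apply] using this
      · apply Finset.sum_eq_zero
        intro j _
        have : A j.1 i = 0 := by
          by_contra hne
          exact hi ((hs _ _ hne).trans j.2)
        rw [this, mul_zero]
    have hcob : Cob 2 univ (∑ j, c' j • ((fun l : List (XX m) => xx m' j (l.map h)) + comb m (A j))) :=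
      Cob.sum _ _ fun j _ => (hA j).smul _
    have hcob2 := hcob.pull (A := univ) h.symm.continuous.continuousOn (mapsTo_univ _ _)
    have hcob3 : Cob 2 univ (comb m' c') := by
      refine hcob2.congr fun l _ => ?_
      have e1 : ∀ j, xx m' j ((l.map h.symm).map h) = xx m' j l := by
        intro j
        congr 1
        rw [List.map_map]
        exact list_map_id_on (A := univ) (fun x _ => h.apply_symm_apply x) (fun _ _ => mem_univ _)
      have e2 : ∑ j, c' j * comb m (A j) (l.map h.symm) = 0 := by
        simp only [comb_apply, Finset.mul_sum]
        rw [Finset.sum_comm]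
        apply Finset.sum_eq_zero
        intro i _
        rw [← zero_mul (xx m i (l.map h.symm)), ← hz i, Finset.sum_mul]
        exact Finset.sum_congr rfl fun j _ => (mul_assoc _ _ _).symm
      rw [comb_apply]
      simp only [Finset.sum_apply, Pi.smul_apply, Pi.add_apply, smul_eq_mul, mul_add,
        Finset.sum_add_distrib]
      rw [e2, add_zero]
      exact Finset.sum_congr rfl fun j _ => by rw [e1]
    have h0 := indep hm' c' hcob3
    intro j
    have := congrFun h0 j.1
    simpa [c', j.2] using this
  have := hv.fintype_card_le_finrank
  rwa [Module.finrank_fintype_fun_eq_card] at this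

lemma multiset_eq {r s : ℕ} {m : Fin r → ℕ} {m' : Fin s → ℕ}
    (h : ∀ k, Fintype.card {j // m' j ≤ k} = Fintype.card {i // m i ≤ k}) :
    (↑(List.ofFn m) : Multiset ℕ) = (↑(List.ofFn m') : Multiset ℕ) := by
  have key : ∀ {r : ℕ} (m : Fin r → ℕ) (k : ℕ), Fintype.card {j // m j ≤ k} =
      ((↑(List.ofFn m) : Multiset ℕ).filter (fun a => a ≤ k)).card := by
    intro r m k
    rw [Fintype.card_subtype, List.ofFn_eq_map]
    rw [← Multiset.map_coe, Multiset.filter_map, Multiset.card_map]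
    rfl
  have step : ∀ (M : Multiset ℕ) (k : ℕ), (M.filter (fun a => a ≤ k + 1)).card =
      (M.filter (fun a => a ≤ k)).card + M.count (k + 1) := by
    intro M k
    induction M using Multiset.induction_on with
    | empty => simp
    | cons a M ih =>
      rw [Multiset.filter_cons, Multiset.filter_cons, Multiset.count_cons, Multiset.card_add,
        Multiset.card_add, ih]
      split_ifs <;> simp <;> omega
  have zero : ∀ M : Multiset ℕ, (M.filter (fun a => a ≤ 0)).card = M.count 0 := by
    intro M
    rw [Multiset.count_eq_card_filter_eq]
    congr 1
    apply Multiset.filter_congr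
    intro a _
    omega
  simp only [key] at h
  ext a
  cases a with
  | zero => rw [← zero, ← zero]; exact (h 0).symm
  | succ k =>
    have h1 := step (↑(List.ofFn m)) k
    have h2 := step (↑(List.ofFn m')) k
    have h3 := h k
    have h4 := h (k + 1)
    omega

end MPS

/-- Let `n` be a positive integer, and let `(m 0, …, m (r-1))` and `(m' 0, …, m' (s-1))` be two
partitions of `n` (tuples of positive integers summing to `n`) which are distinct as multisets.
Then the multiprojective spaces `ℂP^{m 0} × ⋯ × ℂP^{m (r-1)}` and
`ℂP^{m' 0} × ⋯ × ℂP^{m' (s-1)}` are not homeomorphic. -/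
theorem multiprojective_spaces_distinct_partitions_not_homeomorphic
    (n : ℕ) (hn : 0 < n) (r s : ℕ) (m : Fin r → ℕ) (m' : Fin s → ℕ)
    (hm : ∀ i, 0 < m i) (hm' : ∀ j, 0 < m' j)
    (hsum : ∑ i, m i = n) (hsum' : ∑ j, m' j = n)
    (hdistinct : (↑(List.ofFn m) : Multiset ℕ) ≠ (↑(List.ofFn m') : Multiset ℕ)) :
    IsEmpty (((i : Fin r) → Projectivization ℂ (Fin (m i + 1) → ℂ)) ≃ₜ
      ((j : Fin s) → Projectivization ℂ (Fin (m' j + 1) → ℂ))) := by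
  refine ⟨fun h => hdistinct (MPS.multiset_eq fun k => le_antisymm ?_ ?_)⟩
  · exact MPS.card_le hm hm' h k
  · exact MPS.card_le hm' hm h.symm k
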